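/- arXiv:1107.2272 — 2 statements merged into one kernel-verified Lean document; each statement's English description precedes it below -/
import Mathlib

section
/- Let T be a tree on n vertices with a perfect matching and diameter D ≥ 5, let P = v₀v₁…v_D be a diametric path in T, and let w₁,…,w_k be all vertices other than v₃ that are adjacent to v₂ and have degree 2. Then the graph T′ obtained from T by deleting the edges v₂w₁,…,v₂w_k and adding the edges v₃w₁,…,v₃w_k is a tree on n vertices that has a perfect matching, and ξ^ac(T) < ξ^ac(T′). -/
open Finset SimpleGraph

/-- Degree of a vertex `u`: the number of neighbors of `u`. -/
noncomputable def deg {V : Type*} [Fintype V] (G : SimpleGraph V) (u : V) : ℕ :=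
  {v | G.Adj u v}.ncard

/-- `M(u)`: the product of degrees of all neighbors of `u`. -/
noncomputable def Mprod {V : Type*} [Fintype V] (G : SimpleGraph V) (u : V) : ℕ :=
  ∏ᶠ v ∈ {v | G.Adj u v}, deg G v

/-- Eccentricity of a vertex `u`: the maximum distance from `u` to any vertex. -/
noncomputable def ecc {V : Type*} [Fintype V] (G : SimpleGraph V) (u : V) : ℕ :=
  Finset.univ.sup fun v => G.dist u v

/-- Diameter of a graph: the maximum distance between two vertices. -/
noncomputable def gdiam {V : Type*} [Fintype V] (G : SimpleGraph V) : ℕ :=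
  Finset.univ.sup fun u => ecc G u

/-- The augmented eccentric connectivity index `ξ^{ac}(G) = ∑_u M(u)/ε(u)`. -/
noncomputable def xiAC {V : Type*} [Fintype V] (G : SimpleGraph V) : ℝ :=
  ∑ u : V, (Mprod G u : ℝ) / (ecc G u : ℝ)

theorem dist_eq_add_one_of_adj_of_adj {V : Type*} {G : SimpleGraph V} (hG : G.IsTree)
    {r a b c : V} (hab : G.Adj a b) (hbc : G.Adj b c) (hac : a ≠ c)
    (h : G.dist r b = G.dist r a + 1) : G.dist r c = G.dist r b + 1 := by
  rcases hG.dist_eq_dist_add_one_of_adj r hbc with h' | h'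
  · exfalso
    obtain ⟨p, hp, hpl⟩ := hG.connected.exists_path_of_dist r a
    obtain ⟨q, hq, hql⟩ := hG.connected.exists_path_of_dist r c
    have h1 : (p.concat hab).IsPath :=
      Walk.isPath_of_length_eq_dist _ (by rw [Walk.length_concat, h, hpl])
    have h2 : (q.concat hbc.symm).IsPath :=
      Walk.isPath_of_length_eq_dist _ (by rw [Walk.length_concat, h', hql])
    have h3 : p.concat hab = q.concat hbc.symm :=
      congrArg Subtype.val ((hG.isAcyclic.subsingleton_path r b).elim ⟨_, h1⟩ ⟨_, h2⟩)
    have h4 := congrArg Walk.penultimate h3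
    simp only [Walk.penultimate_concat] at h4
    exact hac h4
  · exact h'

theorem dist_eq_add_of_path {V : Type*} {G : SimpleGraph V} (hG : G.IsTree) (r : V)
    (f : ℕ → V) (m : ℕ) (hadj : ∀ i < m, G.Adj (f i) (f (i + 1)))
    (hne : ∀ i, i + 2 ≤ m → f i ≠ f (i + 2))
    (h : G.dist r (f 1) = G.dist r (f 0) + 1) :
    ∀ i ≤ m, G.dist r (f i) = G.dist r (f 0) + i := by
  suffices H : ∀ i, i + 1 ≤ m → G.dist r (f (i + 1)) = G.dist r (f i) + 1 by
    intro i
    induction i with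
    | zero => simp
    | succ i ih =>
      intro hi
      have := ih (by omega)
      have := H i hi
      omega
  intro i
  induction i with
  | zero => intro _; exact h
  | succ i ih =>
    intro hi
    exact dist_eq_add_one_of_adj_of_adj hG (hadj i (by omega)) (hadj (i + 1) (by omega))
      (hne i (by omega)) (ih (by omega))

theorem dist_map_le {V : Type*} {G H : SimpleGraph V} (hG : G.Connected) (f : V → V)
    (hf : ∀ a b, G.Adj a b → f a = f b ∨ H.Adj (f a) (f b)) (x y : V) :
    H.Reachable (f x) (f y) ∧ H.dist (f x) (f y) ≤ G.dist x y := by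
  have key : ∀ {x y : V} (p : G.Walk x y), ∃ q : H.Walk (f x) (f y), q.length ≤ p.length := by
    intro x y p
    induction p with
    | nil => exact ⟨Walk.nil, le_rfl⟩
    | @cons u v w h p ih =>
      obtain ⟨q, hq⟩ := ih
      rcases hf _ _ h with h' | h'
      · exact ⟨q.copy h'.symm rfl, by simp; omega⟩
      · exact ⟨Walk.cons h' q, by simpa using hq⟩
  obtain ⟨p, hp⟩ := hG.exists_walk_length_eq_dist x y
  obtain ⟨q, hq⟩ := key p
  exact ⟨q.reachable, (dist_le q).trans (hp ▸ hq)⟩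

theorem dist_le_ecc {V : Type*} [Fintype V] (G : SimpleGraph V) (x y : V) :
    G.dist x y ≤ ecc G x :=
  Finset.le_sup (f := fun v => G.dist x v) (Finset.mem_univ y)

theorem dist_le_gdiam {V : Type*} [Fintype V] (G : SimpleGraph V) (x y : V) :
    G.dist x y ≤ gdiam G :=
  (dist_le_ecc G x y).trans (Finset.le_sup (f := fun v => ecc G v) (Finset.mem_univ x))

theorem ecc_le {V : Type*} [Fintype V] {G : SimpleGraph V} {x : V} {m : ℕ}
    (h : ∀ y, G.dist x y ≤ m) : ecc G x ≤ m :=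
  Finset.sup_le fun y _ => h y

theorem ecc_pos {V : Type*} [Fintype V] {G : SimpleGraph V} (hG : G.Connected) {x y : V}
    (h : x ≠ y) : 0 < ecc G x :=
  (hG.pos_dist_of_ne h).trans_le (dist_le_ecc G x y)

/-- `c` and `b` are adjacent, and the component of `b` after deleting the edge `bc` is formed by
`b`, its pendent neighbors `U`, and its neighbors `W`, where each `w ∈ W` carries exactly one
further vertex, the pendent vertex `l w`. -/
structure IsBroom {V : Type*} (G : SimpleGraph V) (b c : V) (U W : Finset V) (l : V → V) :
    Prop where
  adj_iff : ∀ x, G.Adj b x ↔ x = c ∨ x ∈ U ∨ x ∈ W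
  adj_iff_of_mem_U : ∀ u ∈ U, ∀ x, G.Adj u x ↔ x = b
  adj_iff_of_mem_W : ∀ w ∈ W, ∀ x, G.Adj w x ↔ x = b ∨ x = l w
  adj_leaf_iff : ∀ w ∈ W, ∀ x, G.Adj (l w) x ↔ x = w
  leaf_ne : ∀ w ∈ W, l w ≠ b
  notMem_U : c ∉ U
  notMem_W : c ∉ W

/-- `H` arises from `G` by replacing the edges from `b` to `W` with edges from `c` to `W`. -/
def IsShift {V : Type*} (G H : SimpleGraph V) (b c : V) (W : Finset V) : Prop :=
  ∀ x y, H.Adj x y ↔ (G.Adj x y ∧ ¬ (x = b ∧ y ∈ W) ∧ ¬ (y = b ∧ x ∈ W)) ∨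
    (x = c ∧ y ∈ W) ∨ (y = c ∧ x ∈ W)

theorem deg_eq_one_iff {V : Type*} [Fintype V] {G : SimpleGraph V} {x : V} :
    deg G x = 1 ↔ ∃ y, ∀ z, G.Adj x z ↔ z = y := by
  simp [deg, Set.ncard_eq_one, Set.ext_iff]

theorem deg_eq_two_iff {V : Type*} [Fintype V] {G : SimpleGraph V} {x : V} :
    deg G x = 2 ↔ ∃ y y', y ≠ y' ∧ ∀ z, G.Adj x z ↔ z = y ∨ z = y' := by
  simp [deg, Set.ncard_eq_two, Set.ext_iff]

/-- The first three vertices of a longest path in a tree with a perfect matching (given by the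
partner map `m`) lie in a broom attached to the fourth vertex. -/
theorem exists_isBroom {V : Type*} [Fintype V] {G : SimpleGraph V} (hG : G.IsTree)
    {m : V → V} (hm : ∀ v, G.Adj v (m v)) (hmm : ∀ v, m (m v) = v)
    {D : ℕ} (hD : ∀ x y, G.dist x y ≤ D) (hD5 : 5 ≤ D) (f : ℕ → V)
    (hadj : ∀ i < D, G.Adj (f i) (f (i + 1)))
    (hinj : ∀ i ≤ D, ∀ j ≤ D, f i = f j → i = j) :
    ∃ (U W : Finset V) (l : V → V), IsBroom G (f 2) (f 3) U W l ∧
      (∀ x, x ∈ W ↔ x ≠ f 3 ∧ G.Adj (f 2) x ∧ deg G x = 2) ∧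
      f 1 ∈ W ∧ (∀ w ∈ W, m w ≠ f 2) ∧
      (∀ x, x = f 2 ∨ x ∈ U ∨ x ∈ W ∨ (∃ w ∈ W, x = l w) ∨ G.dist x (f 3) + 3 ≤ D) ∧
      D ≤ ecc G (f 2) + 2 ∧ (∀ x, x ∈ U ∨ x ∈ W → D ≤ ecc G x + 1) ∧
      (∀ w ∈ W, D ≤ ecc G (l w)) := by
  classical
  have far : ∀ x, G.dist x (f 2) = G.dist x (f 3) + 1 → G.dist x (f 3) + 3 ≤ D := by
    intro x hx
    have h := dist_eq_add_of_path hG x (fun i => f (3 - i)) 3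
      (fun i hi => by
        have := (hadj (2 - i) (by omega)).symm
        rwa [show 2 - i + 1 = 3 - i by omega, show 2 - i = 3 - (i + 1) by omega] at this)
      (fun i hi e => by have := hinj _ (by omega) _ (by omega) e; omega) (by simpa using hx) 3 le_rfl
    have h2 := hD x (f (3 - 3))
    rw [h] at h2
    exact h2
  have near : ∀ x, G.dist x (f 3) = G.dist x (f 2) + 1 →
      G.dist x (f D) = G.dist x (f 2) + (D - 2) := by
    intro x hx
    have h := dist_eq_add_of_path hG x (fun i => f (2 + i)) (D - 2)
      (fun i hi => hadj (2 + i) (by omega))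
      (fun i hi e => by have := hinj _ (by omega) _ (by omega) e; omega) hx (D - 2) le_rfl
    rwa [show 2 + (D - 2) = D by omega] at h
  have hbc : G.Adj (f 2) (f 3) := hadj 2 (by omega)
  have hb : G.dist (f 2) (f 3) = G.dist (f 2) (f 2) + 1 := by
    rw [dist_eq_one_iff_adj.2 hbc, SimpleGraph.dist_self]
  have child : ∀ x, G.Adj (f 2) x → x ≠ f 3 →
      G.dist x (f 2) = 1 ∧ G.dist x (f 3) = G.dist x (f 2) + 1 := by
    intro x hx hne
    have h1 : G.dist x (f 2) = 1 := dist_eq_one_iff_adj.2 hx.symm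
    exact ⟨h1, dist_eq_add_one_of_adj_of_adj hG hx.symm hbc hne (by rw [h1, SimpleGraph.dist_self])⟩
  have grand : ∀ x y, G.Adj (f 2) x → x ≠ f 3 → G.Adj x y → y ≠ f 2 →
      G.dist y (f 2) = 2 ∧ G.dist y (f 3) = G.dist y (f 2) + 1 ∧ ∀ z, G.Adj y z ↔ z = x := by
    intro x y hx hxc hxy hy
    have h1 : G.dist y x = G.dist y y + 1 := by
      rw [SimpleGraph.dist_self, dist_eq_one_iff_adj.2 hxy.symm]
    have h2 := dist_eq_add_one_of_adj_of_adj hG hxy.symm hx.symm hy h1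
    have h3 := dist_eq_add_one_of_adj_of_adj hG hx.symm hbc hxc h2
    rw [SimpleGraph.dist_self] at h1
    refine ⟨by omega, h3, fun z => ⟨fun hz => ?_, fun e => e ▸ hxy.symm⟩⟩
    by_contra hzx
    have k1 : G.dist z y = G.dist z z + 1 := by
      rw [SimpleGraph.dist_self, dist_eq_one_iff_adj.2 hz.symm]
    have k2 := dist_eq_add_one_of_adj_of_adj hG hz.symm hxy.symm hzx k1
    have k3 := dist_eq_add_one_of_adj_of_adj hG hxy.symm hx.symm hy k2
    have k4 := near z (dist_eq_add_one_of_adj_of_adj hG hx.symm hbc hxc k3)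
    have k5 := hD z (f D)
    omega
  have leaf : ∀ x y, (∀ z, G.Adj y z ↔ z = x) → m y = x ∧ m x = y := by
    intro x y h
    have := (h (m y)).1 (hm y)
    exact ⟨this, by rw [← this, hmm]⟩
  have two : ∀ x, G.Adj (f 2) x → x ≠ f 3 → (∃ y, G.Adj x y ∧ y ≠ f 2) →
      ∃ y, y ≠ f 2 ∧ (∀ z, G.Adj x z ↔ z = f 2 ∨ z = y) ∧ (∀ z, G.Adj y z ↔ z = x) := by
    rintro x hx hxc ⟨y, hxy, hy⟩
    obtain ⟨-, -, hl⟩ := grand x y hx hxc hxy hy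
    refine ⟨y, hy, fun z => ⟨fun hz => ?_, ?_⟩, hl⟩
    · by_contra! hcon
      obtain ⟨-, -, hl'⟩ := grand x z hx hxc hz hcon.1
      exact hcon.2 ((leaf _ _ hl').2.symm.trans (leaf _ _ hl).2)
    · rintro (rfl | rfl)
      exacts [hx.symm, hxy]
  let U : Finset V := univ.filter fun x => x ≠ f 3 ∧ G.Adj (f 2) x ∧ deg G x = 1
  let W : Finset V := univ.filter fun x => x ≠ f 3 ∧ G.Adj (f 2) x ∧ deg G x = 2
  have hU : ∀ x, x ∈ U ↔ x ≠ f 3 ∧ G.Adj (f 2) x ∧ deg G x = 1 := by simp [U]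
  have hW : ∀ x, x ∈ W ↔ x ≠ f 3 ∧ G.Adj (f 2) x ∧ deg G x = 2 := by simp [W]
  have hU' : ∀ u ∈ U, ∀ z, G.Adj u z ↔ z = f 2 := by
    intro u hu
    obtain ⟨-, h, hd⟩ := (hU u).1 hu
    obtain ⟨y, hy⟩ := deg_eq_one_iff.1 hd
    rwa [← (hy _).1 h.symm] at hy
  have hW' : ∀ w ∈ W, ∃ y, y ≠ f 2 ∧ (∀ z, G.Adj w z ↔ z = f 2 ∨ z = y) ∧
      (∀ z, G.Adj y z ↔ z = w) := by
    intro w hw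
    obtain ⟨hc, h, hd⟩ := (hW w).1 hw
    obtain ⟨y, y', hyy, hy⟩ := deg_eq_two_iff.1 hd
    refine two w h hc ?_
    by_cases e : y = f 2
    · exact ⟨y', (hy _).2 (Or.inr rfl), fun e' => hyy (e.trans e'.symm)⟩
    · exact ⟨y, (hy _).2 (Or.inl rfl), e⟩
  have mem_W : ∀ x, G.Adj (f 2) x → x ≠ f 3 → (∃ y, G.Adj x y ∧ y ≠ f 2) → x ∈ W := by
    intro x hx hxc h
    obtain ⟨y, hy, hxy, -⟩ := two x hx hxc h
    exact (hW x).2 ⟨hxc, hx, deg_eq_two_iff.2 ⟨_, _, hy.symm, hxy⟩⟩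
  choose! l hl using hW'
  have hleafd : ∀ w ∈ W, G.dist (l w) (f 2) = 2 ∧
      G.dist (l w) (f 3) = G.dist (l w) (f 2) + 1 := by
    intro w hw
    have := grand w (l w) ((hW w).1 hw).2.1 ((hW w).1 hw).1 (((hl w hw).2.1 _).2 (Or.inr rfl))
      (hl w hw).1
    exact ⟨this.1, this.2.1⟩
  refine ⟨U, W, l, ⟨?_, hU', fun w hw => (hl w hw).2.1, fun w hw => (hl w hw).2.2,
    fun w hw => (hl w hw).1, by simp [U], by simp [W]⟩, hW, ?_, ?_, ?_, ?_, ?_, ?_⟩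
  · intro x
    constructor
    · intro hx
      by_cases hxc : x = f 3
      · exact Or.inl hxc
      by_cases h : ∃ y, G.Adj x y ∧ y ≠ f 2
      · exact Or.inr (Or.inr (mem_W x hx hxc h))
      · push Not at h
        refine Or.inr (Or.inl ((hU x).2 ⟨hxc, hx, deg_eq_one_iff.2 ⟨f 2, fun z => ?_⟩⟩))
        exact ⟨h z, fun e => e ▸ hx.symm⟩
    · rintro (rfl | h | h)
      exacts [hbc, ((hU x).1 h).2.1, ((hW x).1 h).2.1]
  · refine mem_W _ (hadj 1 (by omega)).symm (fun e => ?_)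
      ⟨f 0, (hadj 0 (by omega)).symm, fun e => ?_⟩
    · have := hinj _ (by omega) _ (by omega) e; omega
    · have := hinj _ (by omega) _ (by omega) e; omega
  · intro w hw e
    exact (hl w hw).1 ((leaf _ _ (hl w hw).2.2).2.symm.trans e)
  · intro x
    rcases hG.dist_eq_dist_add_one_of_adj x hbc with h | h
    · exact Or.inr (Or.inr (Or.inr (Or.inr (far x h))))
    have h1 := near x h
    have h2 := hD x (f D)
    have h3 : G.dist x (f 2) ≤ 2 := by omega
    obtain ⟨p, hp⟩ := hG.connected.exists_walk_length_eq_dist x (f 2)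
    have sub : ∀ y, G.Adj (f 2) y → y ≠ f 3 → y ∈ U ∨ y ∈ W := by
      intro y hy hyc
      by_cases h : ∃ z, G.Adj y z ∧ z ≠ f 2
      · exact Or.inr (mem_W y hy hyc h)
      · push Not at h
        refine Or.inl ((hU y).2 ⟨hyc, hy, deg_eq_one_iff.2 ⟨f 2, fun z => ?_⟩⟩)
        exact ⟨h z, fun e => e ▸ hy.symm⟩
    by_cases hxb : x = f 2
    · exact Or.inl hxb
    by_cases hxa : G.Adj (f 2) x
    · have : x ≠ f 3 := by
        rintro rfl
        simp at h
      have := sub x hxa this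
      tauto
    have h4 : G.dist x (f 2) = 2 := by
      have h5 : G.dist x (f 2) ≠ 0 := fun h0 => hxb (hG.connected.dist_eq_zero_iff.1 h0)
      have h6 : G.dist x (f 2) ≠ 1 := fun h0 => hxa (dist_eq_one_iff_adj.1 h0).symm
      omega
    have : ∃ y, G.Adj x y ∧ G.Adj y (f 2) := by
      rw [h4] at hp
      have hv0 := p.adj_getVert_succ (i := 0) (by omega)
      have hv1 := p.adj_getVert_succ (i := 1) (by omega)
      rw [p.getVert_of_length_le (i := 1 + 1) (by omega)] at hv1
      rw [p.getVert_zero] at hv0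
      exact ⟨_, hv0, hv1⟩
    obtain ⟨y, hxy, hyb⟩ := this
    have hyc : y ≠ f 3 := by
      rintro rfl
      rw [dist_eq_one_iff_adj.2 hxy] at h
      omega
    have hyW := mem_W y hyb.symm hyc ⟨x, hxy.symm, hxb⟩
    refine Or.inr (Or.inr (Or.inr (Or.inl ⟨y, hyW, ?_⟩)))
    exact (((hl y hyW).2.1 x).1 hxy.symm).resolve_left hxb
  · have h1 := near (f 2) hb
    have h2 := dist_le_ecc G (f 2) (f D)
    rw [SimpleGraph.dist_self] at h1
    omega
  · intro x hx
    have hx' : G.Adj (f 2) x ∧ x ≠ f 3 := by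
      rw [hU, hW] at hx
      tauto
    obtain ⟨h1, h2⟩ := child x hx'.1 hx'.2
    have h3 := near x h2
    have h4 := dist_le_ecc G x (f D)
    omega
  · intro w hw
    obtain ⟨h1, h2⟩ := hleafd w hw
    have h3 := near _ h2
    have h4 := dist_le_ecc G (l w) (f D)
    omega

section Shift

variable {V : Type*} {G H : SimpleGraph V} {b c : V} {U W : Finset V} {l : V → V}

theorem IsBroom.dist_shift_le_of_notMem_branch (hB : IsBroom G b c U W l)
    (hH : IsShift G H b c W) (hG : G.Connected) {x y : V}
    (hx : ¬ (x ∈ W ∨ ∃ w ∈ W, x = l w)) (hy : ¬ (y ∈ W ∨ ∃ w ∈ W, y = l w)) :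
    H.Reachable x y ∧ H.dist x y ≤ G.dist x y := by
  classical
  let f : V → V := fun x => if x ∈ W ∨ ∃ w ∈ W, x = l w then b else x
  have h1 : ∀ x, (x ∈ W ∨ ∃ w ∈ W, x = l w) → f x = b := fun x h => if_pos h
  have h2 : ∀ x, ¬ (x ∈ W ∨ ∃ w ∈ W, x = l w) → f x = x := fun x h => if_neg h
  have key : ∀ a d, G.Adj a d → (a ∈ W ∨ ∃ w ∈ W, a = l w) →
      ¬ (d ∈ W ∨ ∃ w ∈ W, d = l w) → d = b := by
    rintro a d had (ha | ⟨w, hw, rfl⟩) hd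
    · exact ((hB.adj_iff_of_mem_W a ha d).1 had).resolve_right fun e => hd (Or.inr ⟨a, ha, e⟩)
    · exact absurd (Or.inl ((hB.adj_leaf_iff w hw d).1 had ▸ hw)) hd
  have := dist_map_le (H := H) hG f (fun a d had => by
    by_cases ha : a ∈ W ∨ ∃ w ∈ W, a = l w <;> by_cases hd : d ∈ W ∨ ∃ w ∈ W, d = l w
    · left; rw [h1 a ha, h1 d hd]
    · left; rw [h1 a ha, h2 d hd, key a d had ha hd]
    · left; rw [h2 a ha, h1 d hd, key d a had.symm hd ha]
    · right
      rw [h2 a ha, h2 d hd, hH]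
      exact Or.inl ⟨had, fun h => hd (Or.inl h.2), fun h => ha (Or.inl h.2)⟩) x y
  rwa [h2 x hx, h2 y hy] at this

theorem IsBroom.dist_shift_le_of_notMem_center (hB : IsBroom G b c U W l)
    (hH : IsShift G H b c W) (hG : G.Connected) {x y : V}
    (hx : ¬ (x = b ∨ x ∈ U)) (hy : ¬ (y = b ∨ y ∈ U)) :
    H.Reachable x y ∧ H.dist x y ≤ G.dist x y := by
  classical
  let f : V → V := fun x => if x = b ∨ x ∈ U then c else x
  have h1 : ∀ x, (x = b ∨ x ∈ U) → f x = c := fun x h => if_pos h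
  have h2 : ∀ x, ¬ (x = b ∨ x ∈ U) → f x = x := fun x h => if_neg h
  have key : ∀ a d, G.Adj a d → (a = b ∨ a ∈ U) → ¬ (d = b ∨ d ∈ U) → d = c ∨ d ∈ W := by
    rintro a d had (rfl | ha) hd
    · have := (hB.adj_iff d).1 had
      tauto
    · exact absurd (Or.inl ((hB.adj_iff_of_mem_U a ha d).1 had)) hd
  have := dist_map_le (H := H) hG f (fun a d had => by
    by_cases ha : a = b ∨ a ∈ U <;> by_cases hd : d = b ∨ d ∈ U
    · left; rw [h1 a ha, h1 d hd]
    · rw [h1 a ha, h2 d hd, hH]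
      rcases key a d had ha hd with h | h
      exacts [Or.inl h.symm, Or.inr (Or.inr (Or.inl ⟨rfl, h⟩))]
    · rw [h2 a ha, h1 d hd, hH]
      rcases key d a had.symm hd ha with h | h
      exacts [Or.inl h, Or.inr (Or.inr (Or.inr ⟨rfl, h⟩))]
    · right
      rw [h2 a ha, h2 d hd, hH]
      exact Or.inl ⟨had, fun h => ha (Or.inl h.1), fun h => hd (Or.inl h.1)⟩) x y
  rwa [h2 x hx, h2 y hy] at this

theorem IsBroom.ne (hB : IsBroom G b c U W l) : c ≠ b :=
  ((hB.adj_iff c).2 (Or.inl rfl)).ne'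

theorem IsBroom.notMem_center_U (hB : IsBroom G b c U W l) : b ∉ U :=
  fun h => G.irrefl ((hB.adj_iff b).2 (Or.inr (Or.inl h)))

theorem IsBroom.notMem_center_W (hB : IsBroom G b c U W l) : b ∉ W :=
  fun h => G.irrefl ((hB.adj_iff b).2 (Or.inr (Or.inr h)))

theorem IsBroom.ne_leaf (hB : IsBroom G b c U W l) {w : V} (hw : w ∈ W) : c ≠ l w := by
  rintro rfl
  have := (hB.adj_leaf_iff w hw b).1 ((hB.adj_iff _).2 (Or.inl rfl)).symm
  exact hB.notMem_center_W (this ▸ hw)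

theorem IsBroom.notMem_W_of_mem_U (hB : IsBroom G b c U W l) {u : V} (hu : u ∈ U) : u ∉ W :=
  fun hw => hB.leaf_ne u hw
    ((hB.adj_iff_of_mem_U u hu _).1 ((hB.adj_iff_of_mem_W u hw _).2 (Or.inr rfl)))

theorem IsBroom.leaf_notMem_U (hB : IsBroom G b c U W l) {w : V} (hw : w ∈ W) : l w ∉ U := by
  intro hu
  have := (hB.adj_leaf_iff w hw b).1 ((hB.adj_iff_of_mem_U _ hu b).2 rfl)
  exact hB.notMem_center_W (this ▸ hw)

theorem IsBroom.leaf_notMem_W (hB : IsBroom G b c U W l) {w : V} (hw : w ∈ W) : l w ∉ W := by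
  intro hu
  have := (hB.adj_leaf_iff w hw b).1 ((hB.adj_iff_of_mem_W _ hu b).2 (Or.inl rfl))
  exact hB.notMem_center_W (this ▸ hw)

theorem IsBroom.shift_adj_center (hB : IsBroom G b c U W l) (hH : IsShift G H b c W) (x : V) :
    H.Adj b x ↔ x = c ∨ x ∈ U := by
  have := hB.notMem_center_W
  have := hB.ne
  have := hB.notMem_W
  have := fun h => hB.notMem_W_of_mem_U (u := x) h
  rw [hH, hB.adj_iff]
  grind

theorem IsBroom.shift_adj_root (hB : IsBroom G b c U W l) (hH : IsShift G H b c W) (x : V) :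
    H.Adj c x ↔ G.Adj c x ∨ x ∈ W := by
  have := hB.notMem_W
  have := hB.ne
  rw [hH]
  grind

theorem IsBroom.shift_adj_of_mem_W (hB : IsBroom G b c U W l) (hH : IsShift G H b c W) {w : V}
    (hw : w ∈ W) (x : V) : H.Adj w x ↔ x = c ∨ x = l w := by
  have := hB.notMem_W
  have := hB.notMem_center_W
  have := hB.leaf_ne w hw
  have := hB.leaf_notMem_W hw
  have := fun h => hB.leaf_notMem_W (w := x) h
  rw [hH, hB.adj_iff_of_mem_W w hw]
  grind

theorem IsBroom.shift_adj_of_ne (hH : IsShift G H b c W) {x : V} (hb : x ≠ b) (hc : x ≠ c)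
    (hw : x ∉ W) (y : V) : H.Adj x y ↔ G.Adj x y := by
  rw [hH]
  grind

theorem IsBroom.not_adj_root (hB : IsBroom G b c U W l) {w : V} (hw : w ∈ W) : ¬ G.Adj c w := by
  intro h
  rcases (hB.adj_iff_of_mem_W w hw c).1 h.symm with h | h
  exacts [hB.ne h, hB.ne_leaf hw h]

theorem IsBroom.shift_connected (hB : IsBroom G b c U W l)
    (hH : IsShift G H b c W) (hG : G.Connected) : H.Connected := by
  have hc : ∀ x, H.Reachable x c := by
    intro x
    have hcb : ¬ (c ∈ W ∨ ∃ w ∈ W, c = l w) := by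
      rintro (h | ⟨w, hw, h⟩)
      exacts [hB.notMem_W h, hB.ne_leaf hw h]
    by_cases hx : x ∈ W ∨ ∃ w ∈ W, x = l w
    · refine (hB.dist_shift_le_of_notMem_center hH hG ?_ ?_).1
      · rcases hx with h | ⟨w, hw, rfl⟩
        · rintro (rfl | h')
          exacts [hB.notMem_center_W h, hB.notMem_W_of_mem_U h' h]
        · rintro (h' | h')
          exacts [hB.leaf_ne w hw h', hB.leaf_notMem_U hw h']
      · rintro (h | h)
        exacts [hB.ne h, hB.notMem_U h]
    · exact (hB.dist_shift_le_of_notMem_branch hH hG hx hcb).1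
  have := hG.nonempty
  exact ⟨fun x y => (hc x).trans (hc y).symm⟩

theorem IsBroom.dist_shift_center_le (hB : IsBroom G b c U W l) (hH : IsShift G H b c W)
    (hG : G.Connected) {D : ℕ} (hD5 : 5 ≤ D)
    (hfar : ∀ x, x = b ∨ x ∈ U ∨ x ∈ W ∨ (∃ w ∈ W, x = l w) ∨ G.dist x c + 3 ≤ D) (x : V) :
    H.dist x c + 3 ≤ D ∧ (x = b → H.dist x c ≤ 1) ∧ (x ∈ U → H.dist x c ≤ 2) ∧
      (x ∈ W → H.dist x c ≤ 1) ∧ ((∃ w ∈ W, x = l w) → H.dist x c ≤ 2) := by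
  have hHc := hB.shift_connected hH hG
  have hbc : H.Adj b c := by
    rw [hH]
    exact Or.inl ⟨(hB.adj_iff c).2 (Or.inl rfl), fun h => hB.notMem_W h.2, fun h => hB.ne h.1⟩
  have h1 : H.dist b c = 1 := dist_eq_one_iff_adj.2 hbc
  have hU : ∀ u ∈ U, H.dist u c ≤ 2 := by
    intro u hu
    have : H.Adj u b := by
      rw [hH]
      exact Or.inl ⟨(hB.adj_iff_of_mem_U u hu b).2 rfl,
        fun h => hB.notMem_center_W h.2, fun h => hB.notMem_W_of_mem_U hu h.2⟩
    have h2 := hHc.dist_triangle (u := u) (v := b) (w := c)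
    have h3 : H.dist u b = 1 := dist_eq_one_iff_adj.2 this
    omega
  have hW : ∀ w ∈ W, H.dist w c = 1 := by
    intro w hw
    exact dist_eq_one_iff_adj.2 ((hH _ _).2 (Or.inr (Or.inr ⟨rfl, hw⟩)))
  have hl : ∀ w ∈ W, H.dist (l w) c ≤ 2 := by
    intro w hw
    have : H.Adj (l w) w := by
      rw [hH]
      exact Or.inl ⟨(hB.adj_leaf_iff w hw w).2 rfl,
        fun h => hB.leaf_ne w hw h.1, fun h => hB.leaf_notMem_W hw h.2⟩
    have h2 := hHc.dist_triangle (u := l w) (v := w) (w := c)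
    have h3 : H.dist (l w) w = 1 := dist_eq_one_iff_adj.2 this
    have := hW w hw
    omega
  refine ⟨?_, fun h => by rw [h, h1], hU x, fun h => (hW x h).le,
    fun ⟨w, hw, h⟩ => h ▸ hl w hw⟩
  by_cases hb : x = b
  · rw [hb, h1]; omega
  by_cases hu : x ∈ U
  · have := hU x hu; omega
  by_cases hw : x ∈ W
  · have := hW x hw; omega
  by_cases hlw : ∃ w ∈ W, x = l w
  · obtain ⟨w, hw', rfl⟩ := hlw
    have := hl w hw'
    omega
  have h2 : G.dist x c + 3 ≤ D :=
    ((((hfar x).resolve_left hb).resolve_left hu).resolve_left hw).resolve_left hlw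
  have h3 := (hB.dist_shift_le_of_notMem_center hH hG (x := x) (y := c)
    (not_or.2 ⟨hb, hu⟩) (by rintro (h | h); exacts [hB.ne h, hB.notMem_U h])).2
  omega

theorem IsBroom.ecc_shift_le [Fintype V] (hB : IsBroom G b c U W l) (hH : IsShift G H b c W)
    (hG : G.Connected) {D : ℕ} (hD5 : 5 ≤ D)
    (hfar : ∀ x, x = b ∨ x ∈ U ∨ x ∈ W ∨ (∃ w ∈ W, x = l w) ∨ G.dist x c + 3 ≤ D)
    (hb : D ≤ ecc G b + 2) (hUW : ∀ x, x ∈ U ∨ x ∈ W → D ≤ ecc G x + 1)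
    (hl : ∀ w ∈ W, D ≤ ecc G (l w)) (x : V) :
    ecc H x ≤ ecc G x ∧ (x = c → ecc H x + 3 ≤ D) ∧ (x ∈ W → ecc H x + 2 ≤ D) := by
  have hHc := hB.shift_connected hH hG
  have hd := hB.dist_shift_center_le hH hG hD5 hfar
  have hD : ∀ y, H.dist c y ≤ D - 3 := by
    intro y
    have := (hd y).1
    rw [SimpleGraph.dist_comm] at this
    omega
  have htri : ∀ m, H.dist x c ≤ m → ecc H x ≤ m + (D - 3) := fun m hm => ecc_le fun y =>
    hHc.dist_triangle.trans (add_le_add hm (hD y))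
  obtain ⟨-, d1, d2, d3, d4⟩ := hd x
  refine ⟨?_, ?_, ?_⟩
  · by_cases h : x = b
    · have := htri _ (d1 h)
      subst h
      omega
    by_cases h' : x ∈ U
    · have := htri _ (d2 h')
      have := hUW x (Or.inl h')
      omega
    by_cases h1 : x ∈ W
    · have := htri _ (d3 h1)
      have := hUW x (Or.inr h1)
      omega
    by_cases h2 : ∃ w ∈ W, x = l w
    · have := htri _ (d4 h2)
      obtain ⟨w, hw, rfl⟩ := h2
      have := hl w hw
      omega
    refine ecc_le fun y => (?_ : _ ≤ G.dist x y).trans (dist_le_ecc G x y)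
    by_cases hy : y = b ∨ y ∈ U
    · refine (hB.dist_shift_le_of_notMem_branch hH hG (not_or.2 ⟨h1, h2⟩) ?_).2
      rintro (h3 | ⟨w, hw, rfl⟩)
      · rcases hy with rfl | hy
        exacts [hB.notMem_center_W h3, hB.notMem_W_of_mem_U hy h3]
      · rcases hy with h3 | hy
        exacts [hB.leaf_ne w hw h3, hB.leaf_notMem_U hw hy]
    · exact (hB.dist_shift_le_of_notMem_center hH hG (not_or.2 ⟨h, h'⟩) hy).2
  · rintro rfl
    have := ecc_le hD
    omega
  · intro h
    have := htri _ (d3 h)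
    omega

end Shift

open Classical in
theorem deg_eq_card_filter {V : Type*} [Fintype V] (G : SimpleGraph V) (x : V) :
    deg G x = (univ.filter (G.Adj x)).card := by
  rw [deg, ← Set.ncard_coe_finset]
  simp

open Classical in
theorem mprod_eq_prod_filter {V : Type*} [Fintype V] (G : SimpleGraph V) (x : V) :
    Mprod G x = ∏ y ∈ univ.filter (G.Adj x), deg G y := by
  rw [Mprod, ← finprod_mem_coe_finset]
  simp

section ShiftDegree

variable {V : Type*} [Fintype V] {G H : SimpleGraph V} {b c : V} {U W : Finset V} {l : V → V}

theorem deg_eq_card_of_forall {x : V} {s : Finset V} (h : ∀ y, G.Adj x y ↔ y ∈ s) :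
    deg G x = s.card := by
  classical
  rw [deg_eq_card_filter]
  congr 1
  ext y
  simp [h]

theorem mprod_eq_prod_of_forall {x : V} {s : Finset V} (h : ∀ y, G.Adj x y ↔ y ∈ s) :
    Mprod G x = ∏ y ∈ s, deg G y := by
  classical
  rw [mprod_eq_prod_filter]
  congr 1
  ext y
  simp [h]

theorem IsBroom.deg_center (hB : IsBroom G b c U W l) : deg G b = 1 + U.card + W.card := by
  classical
  rw [deg_eq_card_of_forall (s := insert c (U ∪ W)) (by simpa using hB.adj_iff),
    Finset.card_insert_of_notMem (by simp [hB.notMem_U, hB.notMem_W]),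
    Finset.card_union_of_disjoint
      (Finset.disjoint_left.2 fun u hu => hB.notMem_W_of_mem_U hu)]
  ring

theorem IsBroom.deg_shift_center (hB : IsBroom G b c U W l) (hH : IsShift G H b c W) :
    deg H b = 1 + U.card := by
  classical
  rw [deg_eq_card_of_forall (s := insert c U) (by simpa using hB.shift_adj_center hH),
    Finset.card_insert_of_notMem hB.notMem_U]
  ring

theorem IsBroom.deg_shift_root (hB : IsBroom G b c U W l) (hH : IsShift G H b c W) :
    deg H c = deg G c + W.card := by
  classical
  rw [deg_eq_card_of_forall (s := univ.filter (G.Adj c) ∪ W)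
      (by simpa using hB.shift_adj_root hH),
    Finset.card_union_of_disjoint, ← deg_eq_card_filter]
  exact Finset.disjoint_left.2 fun x hx hw => hB.not_adj_root hw (by simpa using hx)

theorem IsBroom.deg_of_mem_W (hB : IsBroom G b c U W l) {w : V} (hw : w ∈ W) :
    deg G w = 2 := by
  classical
  rw [deg_eq_card_of_forall (s := {b, l w}) (by simpa using hB.adj_iff_of_mem_W w hw),
    Finset.card_pair (hB.leaf_ne w hw).symm]

theorem IsBroom.deg_shift_of_ne (hB : IsBroom G b c U W l) (hH : IsShift G H b c W) {x : V}
    (hb : x ≠ b) (hc : x ≠ c) : deg H x = deg G x := by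
  classical
  by_cases hw : x ∈ W
  · rw [hB.deg_of_mem_W hw, deg_eq_card_of_forall (s := {c, l x})
      (by simpa using hB.shift_adj_of_mem_W hH hw), Finset.card_pair (hB.ne_leaf hw)]
  · rw [deg_eq_card_filter, deg_eq_card_filter]
    simp only [shift_adj_of_ne hH hb hc hw]

theorem IsBroom.deg_of_mem_U (hB : IsBroom G b c U W l) {u : V} (hu : u ∈ U) : deg G u = 1 := by
  rw [deg_eq_card_of_forall (s := {b}) (by simpa using hB.adj_iff_of_mem_U u hu),
    Finset.card_singleton]

theorem IsBroom.deg_leaf (hB : IsBroom G b c U W l) {w : V} (hw : w ∈ W) : deg G (l w) = 1 := by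
  rw [deg_eq_card_of_forall (s := {w}) (by simpa using hB.adj_leaf_iff w hw),
    Finset.card_singleton]

theorem IsBroom.mprod_center (hB : IsBroom G b c U W l) :
    Mprod G b = deg G c * 2 ^ W.card := by
  classical
  rw [mprod_eq_prod_of_forall (s := insert c (U ∪ W)) (by simpa using hB.adj_iff),
    Finset.prod_insert (by simp [hB.notMem_U, hB.notMem_W]),
    Finset.prod_union (Finset.disjoint_left.2 fun u hu => hB.notMem_W_of_mem_U hu),
    Finset.prod_congr rfl fun u hu => hB.deg_of_mem_U hu,
    Finset.prod_congr rfl fun w hw => hB.deg_of_mem_W hw]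
  simp

theorem IsBroom.mprod_shift_center (hB : IsBroom G b c U W l) (hH : IsShift G H b c W) :
    Mprod H b = deg G c + W.card := by
  classical
  rw [mprod_eq_prod_of_forall (s := insert c U) (by simpa using hB.shift_adj_center hH),
    Finset.prod_insert hB.notMem_U, hB.deg_shift_root hH, Finset.prod_eq_one, mul_one]
  intro u hu
  rw [hB.deg_shift_of_ne hH, hB.deg_of_mem_U hu]
  · rintro rfl; exact hB.notMem_center_U hu
  · rintro rfl; exact hB.notMem_U hu

open Classical in
theorem IsBroom.mprod_root (hB : IsBroom G b c U W l) :
    Mprod G c = (1 + U.card + W.card) * ∏ y ∈ (univ.filter (G.Adj c)).erase b, deg G y := by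
  rw [mprod_eq_prod_filter, ← hB.deg_center,
    Finset.mul_prod_erase _ _ (by simpa using ((hB.adj_iff c).2 (Or.inl rfl)).symm)]

open Classical in
theorem IsBroom.mprod_shift_root (hB : IsBroom G b c U W l) (hH : IsShift G H b c W) :
    Mprod H c =
      (1 + U.card) * 2 ^ W.card * ∏ y ∈ (univ.filter (G.Adj c)).erase b, deg G y := by
  rw [mprod_eq_prod_of_forall (s := univ.filter (G.Adj c) ∪ W)
      (by simpa using hB.shift_adj_root hH),
    Finset.prod_union (Finset.disjoint_left.2 fun x hx hw =>
      hB.not_adj_root hw (by simpa using hx)),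
    ← Finset.mul_prod_erase (univ.filter (G.Adj c)) _
      (show b ∈ _ by simpa using ((hB.adj_iff c).2 (Or.inl rfl)).symm),
    hB.deg_shift_center hH]
  have h1 : ∏ w ∈ W, deg H w = 2 ^ W.card := by
    refine Finset.prod_eq_pow_card fun w hw => ?_
    rw [hB.deg_shift_of_ne hH, hB.deg_of_mem_W hw]
    · rintro rfl; exact hB.notMem_center_W hw
    · rintro rfl; exact hB.notMem_W hw
  have h2 : ∏ y ∈ (univ.filter (G.Adj c)).erase b, deg H y =
      ∏ y ∈ (univ.filter (G.Adj c)).erase b, deg G y := by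
    refine Finset.prod_congr rfl fun y hy => ?_
    simp only [Finset.mem_erase, Finset.mem_filter, Finset.mem_univ, true_and] at hy
    exact hB.deg_shift_of_ne hH hy.1 hy.2.ne'
  rw [h1, h2]
  ring

theorem IsBroom.mprod_of_mem_U (hB : IsBroom G b c U W l) {u : V} (hu : u ∈ U) :
    Mprod G u = 1 + U.card + W.card := by
  rw [mprod_eq_prod_of_forall (s := {b}) (by simpa using hB.adj_iff_of_mem_U u hu),
    Finset.prod_singleton, hB.deg_center]

theorem IsBroom.mprod_shift_of_mem_U (hB : IsBroom G b c U W l) (hH : IsShift G H b c W)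
    {u : V} (hu : u ∈ U) : Mprod H u = 1 + U.card := by
  rw [mprod_eq_prod_of_forall (s := {b}), Finset.prod_singleton, hB.deg_shift_center hH]
  intro y
  rw [shift_adj_of_ne hH, hB.adj_iff_of_mem_U u hu, Finset.mem_singleton]
  · rintro rfl; exact hB.notMem_center_U hu
  · rintro rfl; exact hB.notMem_U hu
  · exact hB.notMem_W_of_mem_U hu

theorem IsBroom.mprod_of_mem_W (hB : IsBroom G b c U W l) {w : V} (hw : w ∈ W) :
    Mprod G w = 1 + U.card + W.card := by
  classical
  rw [mprod_eq_prod_of_forall (s := {b, l w}) (by simpa using hB.adj_iff_of_mem_W w hw),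
    Finset.prod_pair (hB.leaf_ne w hw).symm, hB.deg_center, hB.deg_leaf hw, mul_one]

theorem IsBroom.mprod_shift_of_mem_W (hB : IsBroom G b c U W l) (hH : IsShift G H b c W)
    {w : V} (hw : w ∈ W) : Mprod H w = deg G c + W.card := by
  classical
  rw [mprod_eq_prod_of_forall (s := {c, l w}) (by simpa using hB.shift_adj_of_mem_W hH hw),
    Finset.prod_pair (hB.ne_leaf hw), hB.deg_shift_root hH,
    hB.deg_shift_of_ne hH (hB.leaf_ne w hw) (hB.ne_leaf hw).symm, hB.deg_leaf hw, mul_one]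

theorem IsBroom.mprod_le_mprod_shift (hB : IsBroom G b c U W l) (hH : IsShift G H b c W)
    {x : V} (hb : x ≠ b) (hc : x ≠ c) (hU : x ∉ U) (hW : x ∉ W) : Mprod G x ≤ Mprod H x := by
  classical
  rw [mprod_eq_prod_filter, mprod_eq_prod_filter]
  simp only [shift_adj_of_ne hH hb hc hW]
  refine Finset.prod_le_prod' fun y hy => ?_
  have hy : G.Adj x y := by simpa using hy
  by_cases h1 : y = b
  · subst h1
    rcases (hB.adj_iff x).1 hy.symm with h | h | h
    exacts [absurd h hc, absurd h hU, absurd h hW]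
  by_cases h2 : y = c
  · rw [h2, hB.deg_shift_root hH]
    omega
  · rw [hB.deg_shift_of_ne hH h1 h2]

theorem IsBroom.sum_deg_shift (hB : IsBroom G b c U W l) (hH : IsShift G H b c W) :
    ∑ x, deg H x = ∑ x, deg G x := by
  classical
  have hc : c ∈ univ.erase b := by simp [hB.ne]
  rw [← Finset.add_sum_erase univ (deg H) (Finset.mem_univ b),
    ← Finset.add_sum_erase univ (deg G) (Finset.mem_univ b),
    ← Finset.add_sum_erase _ (deg H) hc, ← Finset.add_sum_erase _ (deg G) hc,
    Finset.sum_congr rfl fun x hx => hB.deg_shift_of_ne hH (x := x)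
      (by simp only [Finset.mem_erase] at hx; tauto) (by simp only [Finset.mem_erase] at hx; tauto),
    hB.deg_shift_center hH, hB.deg_shift_root hH, hB.deg_center]
  ring

theorem IsBroom.shift_isTree (hB : IsBroom G b c U W l) (hH : IsShift G H b c W)
    (hG : G.IsTree) : H.IsTree := by
  classical
  have hdeg : ∀ (K : SimpleGraph V), ∑ x, deg K x = 2 * Nat.card K.edgeSet := by
    intro K
    rw [Nat.card_eq_fintype_card, ← edgeFinset_card, ← sum_degrees_eq_twice_card_edges]
    refine Finset.sum_congr rfl fun x _ => ?_
    rw [deg_eq_card_filter, ← card_neighborFinset_eq_degree]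
    congr 1
    ext y
    simp
  refine isTree_iff_connected_and_card.2 ⟨hB.shift_connected hH hG.connected, ?_⟩
  have h1 := (isTree_iff_connected_and_card.1 hG).2
  have h2 := hB.sum_deg_shift hH
  rw [hdeg, hdeg] at h2
  omega

end ShiftDegree

open Classical in
/-- Lower bounds for the product of the degrees of the neighbors of `c` other than `b`: at most
`|U|` of these neighbors are pendent. -/
theorem IsBroom.le_prod_deg {V : Type*} [Fintype V] {G : SimpleGraph V} {b c a : V}
    {U W : Finset V} {l m : V → V} (hB : IsBroom G b c U W l) (hm : ∀ v, G.Adj v (m v))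
    (hmm : ∀ v, m (m v) = v) (hmW : ∀ w ∈ W, m w ≠ b) (ha : G.Adj c a) (hab : a ≠ b)
    (hda : deg G a ≠ 1) :
    2 ≤ ∏ y ∈ (univ.filter (G.Adj c)).erase b, deg G y ∧
      deg G c ≤ (1 + U.card) * ∏ y ∈ (univ.filter (G.Adj c)).erase b, deg G y := by
  set N := (univ.filter (G.Adj c)).erase b with hN
  have memN : ∀ y, y ∈ N ↔ y ≠ b ∧ G.Adj c y := by simp [hN]
  have hpos : ∀ y, G.Adj c y → 1 ≤ deg G y := by
    intro y hy
    rw [deg_eq_card_filter]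
    exact Finset.card_pos.2 ⟨c, by simpa using hy.symm⟩
  have hcard : deg G c = N.card + 1 := by
    rw [deg_eq_card_filter, hN, Finset.card_erase_add_one]
    simpa using ((hB.adj_iff c).2 (Or.inl rfl)).symm
  refine ⟨?_, ?_⟩
  · have h1 : deg G a ≤ ∏ y ∈ N, deg G y :=
      Finset.single_le_prod' (fun y hy => hpos y ((memN y).1 hy).2) ((memN a).2 ⟨hab, ha⟩)
    have := hpos a ha
    omega
  · have hL : (N.filter fun y => deg G y = 1).card ≤ U.card := by
      have hleaf : ∀ y ∈ N.filter fun y => deg G y = 1, y ≠ b ∧ m c = y := by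
        intro y hy
        rw [Finset.mem_filter, memN] at hy
        obtain ⟨z, hz⟩ := deg_eq_one_iff.1 hy.2
        have h1 := (hz _).1 hy.1.2.symm
        have h2 := (hz _).1 (hm y)
        exact ⟨hy.1.1, by rw [h1, ← h2, hmm]⟩
      rcases (N.filter fun y => deg G y = 1).eq_empty_or_nonempty with h | ⟨y, hy⟩
      · simp [h]
      · have h1 : (N.filter fun y => deg G y = 1).card ≤ 1 :=
          Finset.card_le_one.2 fun p hp q hq => (hleaf p hp).2.symm.trans (hleaf q hq).2
        have h2 : m b ∈ U := by
          rcases (hB.adj_iff _).1 (hm b) with h | h | h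
          · have h3 := hleaf y hy
            rw [← h, hmm] at h3
            exact absurd h3.2.symm h3.1
          · exact h
          · exact absurd (hmm b) (hmW _ h)
        exact h1.trans (Finset.card_pos.2 ⟨_, h2⟩)
    have h1 : 2 ^ N.card ≤ 2 ^ (N.filter fun y => deg G y = 1).card * ∏ y ∈ N, deg G y := by
      rw [← Finset.prod_const, ← Finset.prod_const, Finset.prod_filter,
        ← Finset.prod_mul_distrib]
      refine Finset.prod_le_prod' fun y hy => ?_
      have := hpos y ((memN y).1 hy).2
      split_ifs <;> omega
    have h2 : 2 ^ (N.filter fun y => deg G y = 1).card ≤ 1 + U.card := by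
      have h3 : (N.filter fun y => deg G y = 1).card ≤ 1 := by
        refine Finset.card_le_one.2 fun p hp q hq => ?_
        rw [Finset.mem_filter, memN] at hp hq
        obtain ⟨z, hz⟩ := deg_eq_one_iff.1 hp.2
        obtain ⟨z', hz'⟩ := deg_eq_one_iff.1 hq.2
        rw [← hmm p, ← hmm q, (hz _).1 (hm p), (hz' _).1 (hm q), ← (hz _).1 hp.1.2.symm,
          ← (hz' _).1 hq.1.2.symm]
      interval_cases (N.filter fun y => deg G y = 1).card <;> omega
    calc deg G c = N.card + 1 := hcard
      _ ≤ 2 ^ N.card := Nat.lt_two_pow_self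
      _ ≤ _ := h1
      _ ≤ _ := Nat.mul_le_mul_right _ h2

theorem shift_gain_pos {d e k P Q E : ℝ} (hE : 0 < E) (hk : 0 < k) (he : 0 ≤ e)
    (hP : k + 1 ≤ P) (hQ : 2 ≤ Q) (hd : d ≤ (1 + e) * Q) :
    0 < (d + k - d * P) / E + Q * ((1 + e) * P - (1 + e + k)) / E +
      k * ((d + k) / E - (1 + e + k) / (E + 1)) + e * (-k / (E + 1)) := by
  have h1 : k * (1 + e + k) / (E + 1) < k * (1 + e + k) / E :=
    div_lt_div_of_pos_left (by positivity) hE (by linarith)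
  have h2 : e * k / (E + 1) ≤ e * k / E :=
    div_le_div_of_nonneg_left (by positivity) hE (by linarith)
  have h3 : 0 ≤ ((P - 1 - k) * ((1 + e) * Q - d) + e * k * (Q - 2)) / E :=
    div_nonneg (add_nonneg (mul_nonneg (by linarith) (by linarith))
      (mul_nonneg (by positivity) (by linarith))) hE.le
  calc (0 : ℝ) ≤ _ := h3
    _ = (d + k - d * P) / E + Q * ((1 + e) * P - (1 + e + k)) / E + k * (d + k) / E -
        k * (1 + e + k) / E - e * k / E := by ring
    _ < (d + k - d * P) / E + Q * ((1 + e) * P - (1 + e + k)) / E + k * (d + k) / E -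
        k * (1 + e + k) / (E + 1) - e * k / (E + 1) := by linarith
    _ = _ := by ring

/-- Lower bound for the change of a quotient whose denominator does not grow: a drop of the
numerator is weighted by an `E` below the old denominator, a rise by an `E` above it. -/
theorem div_sub_div_le_of_le {A A' x x' E : ℝ} (hA' : 0 ≤ A') (hx' : 0 < x') (hxx : x' ≤ x)
    (hE : 0 < E) (h : A' ≤ A ∧ E ≤ x ∨ A ≤ A' ∧ x ≤ E) :
    (A' - A) / E ≤ A' / x' - A / x := by
  have hx : 0 < x := hx'.trans_le hxx
  have h1 : A' / x ≤ A' / x' := div_le_div_of_nonneg_left hA' hx' hxx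
  have h2 : (A' - A) / E ≤ (A' - A) / x := by
    rcases h with ⟨h, h'⟩ | ⟨h, h'⟩
    · rw [div_le_div_iff₀ hE hx]
      nlinarith
    · exact div_le_div_of_nonneg_left (by linarith) hx h'
  rw [sub_div A' A x] at h2
  linarith

theorem IsBroom.xiAC_lt_xiAC_shift {V : Type*} [Fintype V] {G H : SimpleGraph V} {b c a : V}
    {U W : Finset V} {l m : V → V} (hB : IsBroom G b c U W l) (hH : IsShift G H b c W)
    (hG : G.Connected) (hm : ∀ v, G.Adj v (m v))
    (hmm : ∀ v, m (m v) = v) (hmW : ∀ w ∈ W, m w ≠ b) (ha : G.Adj c a) (hab : a ≠ b)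
    (hda : deg G a ≠ 1) (hWne : W.Nonempty) {D : ℕ} (hD5 : 5 ≤ D)
    (hfar : ∀ x, x = b ∨ x ∈ U ∨ x ∈ W ∨ (∃ w ∈ W, x = l w) ∨ G.dist x c + 3 ≤ D)
    (hb : D ≤ ecc G b + 2) (hUW : ∀ x, x ∈ U ∨ x ∈ W → D ≤ ecc G x + 1)
    (hl : ∀ w ∈ W, D ≤ ecc G (l w)) (hc : ecc G c + 2 ≤ D) : xiAC G < xiAC H := by
  classical
  obtain ⟨hQ2, hdQ⟩ := hB.le_prod_deg hm hmm hmW ha hab hda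
  have hMc := hB.mprod_root
  have hMc' := hB.mprod_shift_root hH
  set Q := ∏ y ∈ (univ.filter (G.Adj c)).erase b, deg G y
  have hk : 1 ≤ W.card := hWne.card_pos
  have hP : W.card + 1 ≤ 2 ^ W.card := Nat.lt_two_pow_self
  have hd2 : 2 ≤ deg G c := by
    rw [deg_eq_card_filter, ← Finset.card_pair hab]
    refine Finset.card_le_card fun x hx => ?_
    rcases Finset.mem_insert.1 hx with rfl | hx
    · simpa using ha
    · rw [Finset.mem_singleton] at hx
      subst hx
      simpa using ((hB.adj_iff c).2 (Or.inl rfl)).symm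
  obtain ⟨E, rfl⟩ : ∃ E, D = E + 2 := ⟨D - 2, by omega⟩
  have hE : (0 : ℝ) < E := by
    have : 0 < E := by omega
    exact_mod_cast this
  have hecc := hB.ecc_shift_le hH hG hD5 hfar hb hUW hl
  have hHc := hB.shift_connected hH hG
  have hpos : ∀ x, (0 : ℝ) < ecc H x := by
    intro x
    by_cases hx : x = b
    · exact_mod_cast ecc_pos hHc (hx ▸ hB.ne.symm : x ≠ c)
    · exact_mod_cast ecc_pos hHc hx
  have hle : ∀ x, (ecc H x : ℝ) ≤ ecc G x := fun x => by exact_mod_cast (hecc x).1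
  set d := deg G c
  set k := W.card
  set e := U.card
  have hgain := shift_gain_pos (d := d) (e := e) (k := k) (P := 2 ^ k) (Q := Q) hE
    (by exact_mod_cast hk) (Nat.cast_nonneg _) (by exact_mod_cast hP) (by exact_mod_cast hQ2)
    (by exact_mod_cast hdQ)
  let g : V → ℝ := fun x =>
    (if x = b then ((d + k - d * 2 ^ k) / E : ℝ) else 0) +
    (if x = c then (Q * ((1 + e) * 2 ^ k - (1 + e + k)) / E : ℝ) else 0) +
    (if x ∈ W then ((d + k) / E - (1 + e + k) / (E + 1) : ℝ) else 0) +
    (if x ∈ U then (-k / (E + 1) : ℝ) else 0)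
  have hg : ∑ x, g x = (d + k - d * 2 ^ k) / E + Q * ((1 + e) * 2 ^ k - (1 + e + k)) / E +
      k * ((d + k) / E - (1 + e + k) / (E + 1)) + e * (-k / (E + 1) : ℝ) := by
    simp only [g, Finset.sum_add_distrib, Finset.sum_ite_eq', Finset.sum_ite_mem,
      Finset.mem_univ, if_true, Finset.univ_inter, Finset.sum_const, nsmul_eq_mul]
    rfl
  have hterm : ∀ x, g x ≤ (Mprod H x : ℝ) / ecc H x - (Mprod G x : ℝ) / ecc G x := by
    intro x
    by_cases hxb : x = b
    · subst hxb
      have hg' : g x = (d + k - d * 2 ^ k) / E := by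
        simp [g, hB.ne.symm, hB.notMem_center_W, hB.notMem_center_U]
      rw [hg']
      have h1 : (Mprod H x : ℝ) = d + k := by exact_mod_cast hB.mprod_shift_center hH
      have h2 : (Mprod G x : ℝ) = d * 2 ^ k := by exact_mod_cast hB.mprod_center
      rw [← h1, ← h2]
      refine div_sub_div_le_of_le (Nat.cast_nonneg _) (hpos x) (hle x) hE (Or.inl ⟨?_, ?_⟩)
      · rw [hB.mprod_shift_center hH, hB.mprod_center]
        exact_mod_cast (by nlinarith : d + k ≤ d * 2 ^ k)
      · exact_mod_cast (by omega : E ≤ ecc G x)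
    by_cases hxc : x = c
    · subst hxc
      have hg' : g x = Q * ((1 + e) * 2 ^ k - (1 + e + k)) / E := by
        simp [g, hB.ne, hB.notMem_W, hB.notMem_U]
      have h1 : (Mprod H x : ℝ) - Mprod G x = Q * ((1 + e) * 2 ^ k - (1 + e + k)) := by
        rw [hMc, hMc']
        push_cast
        ring
      rw [hg', ← h1]
      refine div_sub_div_le_of_le (Nat.cast_nonneg _) (hpos x) (hle x) hE (Or.inr ⟨?_, ?_⟩)
      · rw [hMc, hMc']
        exact_mod_cast Nat.mul_le_mul_right Q (by nlinarith : 1 + e + k ≤ (1 + e) * 2 ^ k)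
      · exact_mod_cast (by omega : ecc G x ≤ E)
    by_cases hxW : x ∈ W
    · have hxU : x ∉ U := fun h => hB.notMem_W_of_mem_U h hxW
      have hg' : g x = (d + k) / E - (1 + e + k) / (E + 1) := by
        simp [g, hxb, hxc, hxW, hxU]
      rw [hg', hB.mprod_of_mem_W hxW, hB.mprod_shift_of_mem_W hH hxW]
      push_cast
      refine sub_le_sub (div_le_div_of_nonneg_left (by positivity) (hpos x) ?_)
        (div_le_div_of_nonneg_left (by positivity) (by positivity) ?_)
      · have := (hecc x).2.2 hxW
        exact_mod_cast (by omega : ecc H x ≤ E)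
      · have := hUW x (Or.inr hxW)
        exact_mod_cast (by omega : E + 1 ≤ ecc G x)
    by_cases hxU : x ∈ U
    · have hg' : g x = -k / (E + 1) := by simp [g, hxb, hxc, hxW, hxU]
      have h1 : (Mprod H x : ℝ) - Mprod G x = -k := by
        rw [hB.mprod_of_mem_U hxU, hB.mprod_shift_of_mem_U hH hxU]
        push_cast
        ring
      rw [hg', ← h1]
      refine div_sub_div_le_of_le (Nat.cast_nonneg _) (hpos x) (hle x) (by positivity)
        (Or.inl ⟨?_, ?_⟩)
      · rw [hB.mprod_of_mem_U hxU, hB.mprod_shift_of_mem_U hH hxU]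
        exact_mod_cast Nat.le_add_right _ _
      · have := hUW x (Or.inl hxU)
        exact_mod_cast (by omega : E + 1 ≤ ecc G x)
    · have hg' : g x = 0 := by simp [g, hxb, hxc, hxW, hxU]
      rw [hg', sub_nonneg]
      exact div_le_div₀ (Nat.cast_nonneg _)
        (by exact_mod_cast hB.mprod_le_mprod_shift hH hxb hxc hxU hxW) (hpos x) (hle x)
  have hsum := Finset.sum_le_sum fun x (_ : x ∈ univ) => hterm x
  rw [hg, Finset.sum_sub_distrib] at hsum
  rw [xiAC, xiAC]
  linarith

theorem IsBroom.ecc_root_le {V : Type*} [Fintype V] {G : SimpleGraph V} {b c : V}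
    {U W : Finset V} {l : V → V} (hB : IsBroom G b c U W l) (hG : G.Connected) {D : ℕ}
    (hD5 : 5 ≤ D)
    (hfar : ∀ x, x = b ∨ x ∈ U ∨ x ∈ W ∨ (∃ w ∈ W, x = l w) ∨ G.dist x c + 3 ≤ D) :
    ecc G c + 2 ≤ D := by
  have h : ∀ x, G.dist c x ≤ D - 2 := by
    intro x
    have hb : G.dist c b = 1 := dist_eq_one_iff_adj.2 ((hB.adj_iff c).2 (Or.inl rfl)).symm
    have hUW : ∀ y, y ∈ U ∨ y ∈ W → G.dist c y ≤ 2 := by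
      intro y hy
      have h1 : G.dist b y = 1 := dist_eq_one_iff_adj.2 ((hB.adj_iff y).2 (Or.inr hy))
      have := hG.dist_triangle (u := c) (v := b) (w := y)
      omega
    rcases hfar x with rfl | h | h | ⟨w, hw, rfl⟩ | h
    · omega
    · have := hUW x (Or.inl h); omega
    · have := hUW x (Or.inr h); omega
    · have h1 := hUW w (Or.inr hw)
      have h2 : G.dist w (l w) = 1 :=
        dist_eq_one_iff_adj.2 ((hB.adj_iff_of_mem_W w hw _).2 (Or.inr rfl))
      have := hG.dist_triangle (u := c) (v := w) (w := l w)
      omega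
    · rw [SimpleGraph.dist_comm]
      omega
  have := ecc_le h
  omega

theorem exists_isPerfectMatching_of_adj {V : Type*} {G H : SimpleGraph V} {M : G.Subgraph}
    (hM : M.IsPerfectMatching) (h : ∀ x y, M.Adj x y → H.Adj x y) :
    ∃ M' : H.Subgraph, M'.IsPerfectMatching := by
  let M' : H.Subgraph :=
    { verts := Set.univ
      Adj := M.Adj
      adj_sub := h _ _
      edge_vert := fun _ => trivial
      symm := M.symm }
  refine ⟨M', ?_⟩
  rw [Subgraph.isPerfectMatching_iff] at hM ⊢
  exact hM

/-- Theorem: Let `T` be a tree on `n` vertices with a perfect matching and diameter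
`D ≥ 5`, let `P = v₀v₁…v_D` be a diametric path and `w₁, …, w_k` all vertices other than
`v₃` adjacent to `v₂` of degree 2. The graph `T'` obtained by deleting the edges `v₂ wⱼ`
and adding the edges `v₃ wⱼ` is a tree on `n` vertices with a perfect matching and
`ξ^{ac}(T) < ξ^{ac}(T')`. -/
theorem xiAC_matching_step (n : ℕ) {V : Type*} [Fintype V] (T : SimpleGraph V)
    (hT : T.IsTree) (hn : Fintype.card V = n)
    (hpm : ∃ M : T.Subgraph, M.IsPerfectMatching)
    (D : ℕ) (hD : D = gdiam T) (hD5 : 5 ≤ D)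
    (v0 vD : V) (p : T.Walk v0 vD) (hp : p.IsPath) (hlen : p.length = D)
    (k : ℕ) (w : Fin k → V) (hwinj : Function.Injective w)
    (hwall : ∀ x : V, (∃ j, w j = x) ↔
      x ≠ p.getVert 3 ∧ T.Adj (p.getVert 2) x ∧ deg T x = 2)
    (T' : SimpleGraph V)
    (hT' : T' = fromEdgeSet
      ((T.edgeSet \ {e | ∃ j, e = s(p.getVert 2, w j)}) ∪
        {e | ∃ j, e = s(p.getVert 3, w j)})) :
    T'.IsTree ∧ Fintype.card V = n ∧ (∃ M : T'.Subgraph, M.IsPerfectMatching) ∧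
      xiAC T < xiAC T' := by
  obtain ⟨M, hM⟩ := hpm
  have hM' := Subgraph.isPerfectMatching_iff.1 hM
  choose m hm hmu using hM'
  have hmm : ∀ v, m (m v) = v := fun v => (hmu (m v) v (hm v).symm).symm
  have hadj : ∀ i < D, T.Adj (p.getVert i) (p.getVert (i + 1)) :=
    fun i hi => p.adj_getVert_succ (hlen ▸ hi)
  have hinj : ∀ i ≤ D, ∀ j ≤ D, p.getVert i = p.getVert j → i = j :=
    fun i hi j hj e => hp.getVert_injOn (hlen ▸ hi) (hlen ▸ hj) e
  obtain ⟨U, W, l, hB, hW, h1W, hmW, hfar, hb, hUW, hl⟩ :=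
    exists_isBroom hT (fun v => (hm v).adj_sub) hmm (fun x y => hD ▸ dist_le_gdiam T x y) hD5
      p.getVert hadj hinj
  have hwW : ∀ x, (∃ j, w j = x) ↔ x ∈ W := fun x => (hwall x).trans (hW x).symm
  have hH : IsShift T T' (p.getVert 2) (p.getVert 3) W := by
    intro x y
    have h1 : ∀ u, (∃ j, s(x, y) = s(u, w j)) ↔ x = u ∧ y ∈ W ∨ y = u ∧ x ∈ W := by
      intro u
      rw [← hwW, ← hwW]
      simp only [Sym2.eq_iff]
      constructor
      · rintro ⟨j, ⟨rfl, rfl⟩ | ⟨rfl, rfl⟩⟩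
        exacts [Or.inl ⟨rfl, j, rfl⟩, Or.inr ⟨rfl, j, rfl⟩]
      · rintro (⟨rfl, j, rfl⟩ | ⟨rfl, j, rfl⟩)
        exacts [⟨j, Or.inl ⟨rfl, rfl⟩⟩, ⟨j, Or.inr ⟨rfl, rfl⟩⟩]
    rw [hT', fromEdgeSet_adj, Set.mem_union, Set.mem_sdiff, Set.mem_ofPred_eq, Set.mem_ofPred_eq,
      h1, h1, mem_edgeSet, not_or]
    refine ⟨fun h => h.1, fun h => ⟨h, ?_⟩⟩
    rintro rfl
    rcases h with h | ⟨rfl, h⟩ | ⟨rfl, h⟩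
    exacts [T.irrefl h.1, hB.notMem_W h, hB.notMem_W h]
  refine ⟨hB.shift_isTree hH hT, hn, exists_isPerfectMatching_of_adj hM fun x y hxy => ?_, ?_⟩
  · rw [hH]
    refine Or.inl ⟨hxy.adj_sub, ?_, ?_⟩
    · rintro ⟨rfl, hy⟩
      exact hmW y hy (hmu y _ hxy.symm).symm
    · rintro ⟨rfl, hx⟩
      exact hmW x hx (hmu x _ hxy).symm
  · refine hB.xiAC_lt_xiAC_shift hH hT.connected (fun v => (hm v).adj_sub) hmm hmW
      (hadj 3 (by omega)) (fun e => ?_) (fun h => ?_) ⟨_, h1W⟩ hD5 hfar hb hUW hl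
      (hB.ecc_root_le hT.connected hD5 hfar)
    · have := hinj _ (by omega) _ (by omega) e
      omega
    · obtain ⟨z, hz⟩ := deg_eq_one_iff.1 h
      have h3 := (hz _).1 (hadj 3 (by omega)).symm
      have h5 := (hz _).1 (hadj 4 (by omega))
      have := hinj _ (by omega) _ (by omega) (h3.trans h5.symm)
      omega
end

section
/- Let T be a tree on n vertices that has a perfect matching and T ≠ TB_{n,n/2}. Then ξ^ac(T) < ξ^ac(TB_{n,n/2}). -/
open Finset SimpleGraph

/-- `T` is (isomorphic to) the degree balanced tree `TB_{n,k}`: a tree on `n` vertices of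
diameter 4 whose central vertex has degree `k` and in which the degrees of any two
neighbors of the central vertex differ by at most one. -/
def IsTB {V : Type*} [Fintype V] (T : SimpleGraph V) (n k : ℕ) : Prop :=
  T.IsTree ∧ Fintype.card V = n ∧ gdiam T = 4 ∧
  ∃ c : V, (∀ v, ecc T c ≤ ecc T v) ∧ deg T c = k ∧
    ∀ v w, T.Adj c v → T.Adj c w → deg T v ≤ deg T w + 1

open scoped Classical in
/-- The product of the degrees of the neighbors of `u`, as a finset product. -/
noncomputable def neighborDegProd {V : Type*} [Fintype V] (G : SimpleGraph V) (u : V) : ℕ :=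
  ∏ v ∈ G.neighborFinset u, G.degree v

section Numeric

lemma one_add_le_two_pow (a : ℕ) : 1 + a ≤ 2 ^ a := by
  have := Nat.lt_two_pow_self (n := a)
  omega

lemma prod_one_add_le_two_pow_sum {ι : Type*} (s : Finset ι) (a : ι → ℕ) :
    ∏ i ∈ s, (1 + a i) ≤ 2 ^ ∑ i ∈ s, a i := by
  rw [← Finset.prod_pow_eq_pow_sum]
  exact Finset.prod_le_prod' fun i _ => one_add_le_two_pow (a i)

lemma sum_two_pow_succ_le {ι : Type*} (s : Finset ι) (b : ι → ℕ) :
    ∑ i ∈ s, 2 ^ b i + 1 ≤ 2 ^ (∑ i ∈ s, b i) + #s := by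
  classical
  induction s using Finset.induction_on with
  | empty => simp
  | insert i s hi ih =>
    rw [sum_insert hi, sum_insert hi, card_insert_of_notMem hi, pow_add]
    have h1 : 1 ≤ 2 ^ b i := Nat.one_le_two_pow
    have h2 : 1 ≤ 2 ^ ∑ i ∈ s, b i := Nat.one_le_two_pow
    nlinarith

lemma four_mul_one_add_le (a : ℕ) (ha : 2 ≤ a) : 4 * (1 + a) ≤ 3 * 2 ^ a := by
  induction a, ha using Nat.le_induction with
  | base => norm_num
  | succ a _ ih => rw [pow_succ]; omega

lemma sq_add_le_two_pow (n : ℕ) (hn : 3 ≤ n) : n ^ 2 + 13 ≤ 2 ^ n + 6 * n := by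
  induction n, hn using Nat.le_induction with
  | base => norm_num
  | succ n hn ih =>
    have := Nat.lt_two_pow_self (n := n)
    rcases hn.eq_or_lt with rfl | h
    · norm_num
    · have h4 : 2 * n ≤ 2 ^ n := by
        clear ih this
        induction n, h using Nat.le_induction with
        | base => norm_num
        | succ n h ih => have := ih (by omega); rw [pow_succ]; omega
      rw [pow_succ 2 n]; nlinarith

lemma prod_one_add_add_two_pow_le {ι : Type*} (s : Finset ι) (a : ι → ℕ) {k e : ℕ}
    (hs : 1 ≤ #s) (ha : ∑ i ∈ s, a i ≤ k) (he : e + #s ≤ k + 1) :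
    ∏ i ∈ s, (1 + a i) + 2 ^ e + 2 * #s ≤ 2 ^ k + 2 * k + 3 := by
  classical
  have hX := prod_one_add_le_two_pow_sum s a
  have hXk : ∏ i ∈ s, (1 + a i) ≤ 2 ^ k := hX.trans (Nat.pow_le_pow_right two_pos ha)
  by_cases h1 : #s = 1
  · obtain ⟨i, rfl⟩ := Finset.card_eq_one.1 h1
    simp only [prod_singleton, sum_singleton, card_singleton] at *
    have : 2 ^ e ≤ 2 ^ k := Nat.pow_le_pow_right two_pos (by omega)
    omega
  by_cases h2 : k ≤ #s
  · have : 2 ^ e ≤ 2 ^ 1 := Nat.pow_le_pow_right two_pos (by omega)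
    by_cases h3 : #s = k + 1
    · have : e = 0 := by omega
      subst this
      omega
    · omega
  by_cases h3 : #s = 2
  · obtain ⟨i, j, hij, rfl⟩ := Finset.card_eq_two.1 h3
    rw [prod_pair hij]
    rw [sum_pair hij] at ha
    rw [h3] at *
    obtain ⟨n, rfl⟩ : ∃ n, k = n + 1 := ⟨k - 1, by omega⟩
    have hen : 2 ^ e ≤ 2 ^ n := Nat.pow_le_pow_right two_pos (by omega)
    have hq := sq_add_le_two_pow (n + 2) (by omega)
    have hm : 4 * ((1 + a i) * (1 + a j)) ≤ (n + 3) ^ 2 := by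
      have h4 : 4 * ((1 + a i) * (1 + a j)) ≤ ((1 + a i) + (1 + a j)) ^ 2 := by
        zify; nlinarith [sq_nonneg ((a i : ℤ) - a j)]
      exact h4.trans (Nat.pow_le_pow_left (by omega) 2)
    rw [pow_add] at hq ⊢
    nlinarith
  by_cases h4 : ∑ i ∈ s, a i + 1 ≤ k
  · obtain ⟨n, rfl⟩ : ∃ n, k = n + 1 := ⟨k - 1, by omega⟩
    have : 2 ^ e ≤ 2 ^ n := Nat.pow_le_pow_right two_pos (by omega)
    have : 2 ^ (∑ i ∈ s, a i) ≤ 2 ^ n := Nat.pow_le_pow_right two_pos (by omega)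
    rw [pow_succ]
    omega
  · obtain ⟨n, rfl⟩ : ∃ n, k = n + 2 := ⟨k - 2, by omega⟩
    obtain ⟨i, hi, hi2⟩ : ∃ i ∈ s, 2 ≤ a i := by
      by_contra! h
      have : ∑ i ∈ s, a i ≤ #s := by
        simpa using Finset.sum_le_card_nsmul s a 1 fun i hi => by have := h i hi; omega
      omega
    have h5 : 4 * ∏ i ∈ s, (1 + a i) ≤ 3 * 2 ^ (n + 2) := by
      have hsum : 2 ^ (n + 2) ≥ 2 ^ a i * 2 ^ ∑ j ∈ s.erase i, a j := by
        rw [← pow_add, Finset.add_sum_erase _ _ hi]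
        exact Nat.pow_le_pow_right two_pos ha
      rw [← Finset.mul_prod_erase _ _ hi]
      have := prod_one_add_le_two_pow_sum (s.erase i) a
      have := Nat.mul_le_mul (four_mul_one_add_le (a i) hi2) this
      nlinarith
    have : 2 ^ e ≤ 2 ^ n := Nat.pow_le_pow_right two_pos (by omega)
    rw [pow_add] at h5 ⊢
    omega

end Numeric

section Tree

open scoped Classical

variable {V : Type*} {G : SimpleGraph V}

lemma SimpleGraph.IsTree.eq_of_adj_of_dist_succ (hG : G.IsTree) {y z a b : V}
    (ha : G.Adj a z) (hb : G.Adj b z) (hda : G.dist y a + 1 = G.dist y z)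
    (hdb : G.dist y b + 1 = G.dist y z) : a = b := by
  have key : ∀ c, (hc : G.Adj c z) → G.dist y c + 1 = G.dist y z →
      ∃ p : G.Walk y z, p.IsPath ∧ p.penultimate = c := by
    intro c hc hd
    obtain ⟨p, hp⟩ := hG.connected.exists_walk_length_eq_dist y c
    exact ⟨p.concat hc, Walk.isPath_of_length_eq_dist _ (by simp [hp, hd]), by simp⟩
  obtain ⟨p, hp, rfl⟩ := key a ha hda
  obtain ⟨q, hq, rfl⟩ := key b hb hdb
  rw [(hG.existsUnique_path y z).unique hp hq]

lemma SimpleGraph.IsTree.dist_eq_two (hG : G.IsTree) {a b x : V} (hax : G.Adj a x)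
    (hxb : G.Adj x b) (hab : a ≠ b) : G.dist a b = 2 := by
  have h1 : G.dist a x = 1 := dist_eq_one_iff_adj.2 hax
  have h2 := hG.dist_eq_dist_add_one_of_adj a hxb
  have h3 := hG.connected.pos_dist_of_ne hab
  omega

lemma SimpleGraph.Connected.exists_common_neighbor (hG : G.Connected) {u v : V}
    (h : G.dist u v = 2) : ∃ x, G.Adj u x ∧ G.Adj x v := by
  obtain ⟨w, hw⟩ := hG.exists_walk_length_eq_dist u v
  rw [h] at hw
  match w, hw with
  | .cons h1 (.cons h2 .nil), _ => exact ⟨_, h1, h2⟩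

lemma SimpleGraph.IsTree.eq_of_common_neighbors (hG : G.IsTree) {a b x y : V} (hab : a ≠ b)
    (hax : G.Adj a x) (hxb : G.Adj x b) (hay : G.Adj a y) (hyb : G.Adj y b) : x = y := by
  apply hG.eq_of_adj_of_dist_succ (y := a) hxb hyb <;>
  simp [dist_eq_one_iff_adj.2 hax, dist_eq_one_iff_adj.2 hay, hG.dist_eq_two hax hxb hab]

/-- The fixed-point-free involution given by a perfect matching. -/
def IsPartnerMap (G : SimpleGraph V) (σ : V → V) : Prop :=
  (∀ x, G.Adj x (σ x)) ∧ ∀ x, σ (σ x) = x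

lemma exists_isPartnerMap {M : G.Subgraph} (hM : M.IsPerfectMatching) :
    ∃ σ, IsPartnerMap G σ := by
  rw [Subgraph.isPerfectMatching_iff] at hM
  choose σ hσ hu using hM
  exact ⟨σ, fun x => (hσ x).adj_sub, fun x => (hu _ _ (hσ x).symm).symm⟩

lemma SimpleGraph.IsTree.odd_dist_iff (hG : G.IsTree) (r : V) {x y : V} (h : G.Adj x y) :
    Odd (G.dist r x) ↔ Even (G.dist r y) := by
  rcases hG.dist_eq_dist_add_one_of_adj r h with h | h <;> rw [h] <;> grind

/-- The graph obtained by deleting two vertices. -/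
def deletePair (G : SimpleGraph V) (l p : V) : SimpleGraph {x // x ≠ l ∧ x ≠ p} :=
  G.comap Subtype.val

@[simp]
lemma deletePair_adj {x y : {x // x ≠ l ∧ x ≠ p}} : (deletePair G l p).Adj x y ↔ G.Adj x y :=
  Iff.rfl

variable [Fintype V]

lemma IsPartnerMap.one_le_degree {σ : V → V} (hσ : IsPartnerMap G σ) (v : V) :
    1 ≤ G.degree v :=
  Nat.succ_le_of_lt ((G.degree_pos_iff_exists_adj v).2 ⟨_, hσ.1 v⟩)

/-- The vertices whose distance from `r` is odd. -/
noncomputable def oddClass (G : SimpleGraph V) (r : V) : Finset V := {v | Odd (G.dist r v)}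

/-- The vertices whose distance from `r` is even. -/
noncomputable def evenClass (G : SimpleGraph V) (r : V) : Finset V := {v | Even (G.dist r v)}

lemma SimpleGraph.IsTree.isBipartiteWith_classes (hG : G.IsTree) (r : V) :
    G.IsBipartiteWith (oddClass G r) (evenClass G r) where
  disjoint := by
    rw [Finset.disjoint_coe, Finset.disjoint_left]
    intro x hx hy
    simp only [oddClass, evenClass, mem_filter, mem_univ, true_and] at hx hy
    grind
  mem_of_adj x y h := by
    have := hG.odd_dist_iff r h
    have := hG.odd_dist_iff r h.symm
    simp only [oddClass, evenClass, coe_filter, mem_univ, true_and, Set.mem_ofPred_eq]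
    grind

lemma SimpleGraph.IsTree.card_classes (hG : G.IsTree) {σ : V → V} (hσ : IsPartnerMap G σ) (r : V)
    {k : ℕ} (hV : Fintype.card V = 2 * (k + 1)) :
    #(oddClass G r) = k + 1 ∧ #(evenClass G r) = k + 1 := by
  have h1 : #(oddClass G r) = #(evenClass G r) := by
    refine Finset.card_bij' (fun x _ => σ x) (fun x _ => σ x) ?_ ?_ ?_ ?_
    · intro x hx
      simp only [oddClass, evenClass, mem_filter, mem_univ, true_and] at hx ⊢
      exact (hG.odd_dist_iff r (hσ.1 x)).1 hx
    · intro x hx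
      simp only [oddClass, evenClass, mem_filter, mem_univ, true_and] at hx ⊢
      exact (hG.odd_dist_iff r (hσ.1 x).symm).2 hx
    · exact fun x _ => hσ.2 x
    · exact fun x _ => hσ.2 x
  have h2 : #(evenClass G r) + #(oddClass G r) = Fintype.card V := by
    simp only [evenClass, oddClass, ← Nat.not_even_iff_odd]
    exact Finset.card_filter_add_card_filter_not _
  omega

lemma SimpleGraph.IsTree.sum_degree_sub_one (hG : G.IsTree) {σ : V → V} (hσ : IsPartnerMap G σ)
    (r : V) {k : ℕ} (hV : Fintype.card V = 2 * (k + 1)) :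
    ∑ v ∈ oddClass G r, (G.degree v - 1) = k ∧ ∑ v ∈ evenClass G r, (G.degree v - 1) = k := by
  obtain ⟨ho, he⟩ := hG.card_classes hσ r hV
  have hE := hG.card_edgeFinset
  have h1 := isBipartiteWith_sum_degrees_eq_card_edges (hG.isBipartiteWith_classes r)
  have h2 := isBipartiteWith_sum_degrees_eq_card_edges' (hG.isBipartiteWith_classes r)
  have aux : ∀ s : Finset V, ∑ v ∈ s, (G.degree v - 1) + #s = ∑ v ∈ s, G.degree v := by
    intro s
    rw [Finset.card_eq_sum_ones, ← Finset.sum_add_distrib]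
    exact Finset.sum_congr rfl fun v _ =>
      Nat.sub_add_cancel (IsPartnerMap.one_le_degree hσ v)
  have a1 := aux (oddClass G r)
  have a2 := aux (evenClass G r)
  constructor <;> omega

lemma prod_degree_le {σ : V → V} (hσ : IsPartnerMap G σ) (s : Finset V) :
    ∏ v ∈ s, G.degree v ≤ 2 ^ ∑ v ∈ s, (G.degree v - 1) := by
  refine le_trans (le_of_eq (Finset.prod_congr rfl fun v _ => ?_)) (prod_one_add_le_two_pow_sum s _)
  have := IsPartnerMap.one_le_degree hσ v
  omega

lemma SimpleGraph.IsTree.neighborDegProd_add_sum_le [DecidableEq V] (hG : G.IsTree) {σ : V → V}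
    (hσ : IsPartnerMap G σ) (q : V) {k : ℕ} (hV : Fintype.card V = 2 * (k + 1)) :
    neighborDegProd G q
      + ∑ u ∈ G.neighborFinset q, ∏ v ∈ (G.neighborFinset u).erase q, G.degree v
      + G.degree q ≤ 2 ^ k + 2 * (k + 1) := by
  obtain ⟨ho, he⟩ := hG.sum_degree_sub_one hσ q hV
  have hd := IsPartnerMap.one_le_degree hσ q
  have hX : neighborDegProd G q = ∏ u ∈ G.neighborFinset q, (1 + (G.degree u - 1)) :=
    Finset.prod_congr rfl fun v _ => by
      have := IsPartnerMap.one_le_degree hσ v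
      omega
  have hodd : G.neighborFinset q ⊆ oddClass G q := by
    intro u hu
    have : G.dist q u = 1 := dist_eq_one_iff_adj.2 (by simpa using hu)
    simp [oddClass, this]
  set b : V → ℕ := fun u => ∑ v ∈ (G.neighborFinset u).erase q, (G.degree v - 1) with hb
  have hY : ∑ u ∈ G.neighborFinset q, ∏ v ∈ (G.neighborFinset u).erase q, G.degree v
      ≤ ∑ u ∈ G.neighborFinset q, 2 ^ b u :=
    Finset.sum_le_sum fun u _ => prod_degree_le hσ _
  have hY2 := sum_two_pow_succ_le (G.neighborFinset q) b
  have hbsum : ∑ u ∈ G.neighborFinset q, b u + (G.degree q - 1) ≤ k := by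
    have hdisj : Set.PairwiseDisjoint (G.neighborFinset q : Set V)
        fun u => (G.neighborFinset u).erase q := by
      intro u hu u' hu' huu
      simp only [coe_neighborFinset, mem_neighborSet] at hu hu'
      rw [Function.onFun, Finset.disjoint_left]
      intro v hv hv'
      simp only [mem_erase, mem_neighborFinset] at hv hv'
      exact huu (hG.eq_of_common_neighbors hv.1.symm hu hv.2 hu' hv'.2)
    have hsub : (G.neighborFinset q).biUnion (fun u => (G.neighborFinset u).erase q)
        ⊆ (evenClass G q).erase q := by
      intro v hv
      simp only [mem_biUnion, mem_erase, mem_neighborFinset] at hv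
      obtain ⟨u, hu, hvq, huv⟩ := hv
      simp [evenClass, hvq, hG.dist_eq_two hu huv hvq.symm]
    rw [hb, ← Finset.sum_biUnion hdisj]
    have hq : q ∈ evenClass G q := by simp [evenClass]
    have := Finset.sum_erase_add (evenClass G q) (fun v => G.degree v - 1) hq
    have := Finset.sum_le_sum_of_subset (f := fun v => G.degree v - 1) hsub
    omega
  have hcard : #(G.neighborFinset q) = G.degree q := G.card_neighborFinset_eq_degree q
  have := prod_one_add_add_two_pow_le (G.neighborFinset q) (fun u => G.degree u - 1)
    (k := k) (e := ∑ u ∈ G.neighborFinset q, b u) (by omega)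
    (ho ▸ Finset.sum_le_sum_of_subset hodd) (by omega)
  omega

lemma SimpleGraph.IsTree.exists_pendant_pair (hG : G.IsTree) {σ : V → V} (hσ : IsPartnerMap G σ) {k : ℕ}
    (hV : Fintype.card V = 2 * (k + 2)) :
    ∃ l p q, σ l = p ∧ σ p = l ∧ q ≠ l ∧ q ≠ p ∧ G.neighborFinset l = {p} ∧
      G.neighborFinset p = {l, q} := by
  obtain ⟨x, hx⟩ : ∃ x, G.degree x + G.degree (σ x) ≤ 3 := by
    by_contra! h
    have h1 : ∑ x, G.degree (σ x) = ∑ x, G.degree x :=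
      Equiv.sum_comp ⟨σ, σ, hσ.2, hσ.2⟩ fun x => G.degree x
    have h2 := G.sum_degrees_eq_twice_card_edges
    have h3 := hG.card_edgeFinset
    have h4 : ∑ _x : V, 4 ≤ ∑ x, (G.degree x + G.degree (σ x)) :=
      Finset.sum_le_sum fun x _ => h x
    simp only [sum_const, card_univ, smul_eq_mul, Finset.sum_add_distrib, h1] at h4
    omega
  obtain ⟨l, hl, hp⟩ : ∃ l, G.degree l = 1 ∧ G.degree (σ l) ≤ 2 := by
    have h1 := IsPartnerMap.one_le_degree hσ x
    have h2 := IsPartnerMap.one_le_degree hσ (σ x)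
    by_cases h : G.degree x = 1
    · exact ⟨x, h, by omega⟩
    · exact ⟨σ x, by omega, by rw [hσ.2]; omega⟩
  have hNl : G.neighborFinset l = {σ l} := by
    obtain ⟨y, hy⟩ := Finset.card_eq_one.1 ((G.card_neighborFinset_eq_degree l).trans hl)
    have : σ l ∈ G.neighborFinset l := by simpa using hσ.1 l
    rw [hy, mem_singleton] at this
    rw [hy, this]
  have hlp : l ∈ G.neighborFinset (σ l) := by simpa using (hσ.1 l).symm
  obtain ⟨q, hq, hql⟩ : ∃ q, G.Adj (σ l) q ∧ q ≠ l := by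
    by_contra! h
    obtain ⟨z, hz⟩ : ∃ z, z ∉ ({l, σ l} : Finset V) := by
      by_contra! hall
      have := (Finset.card_le_card fun z (_ : z ∈ univ) => hall z).trans Finset.card_le_two
      rw [card_univ] at this
      omega
    obtain ⟨w⟩ := hG.connected l z
    obtain ⟨d, -, hd1, hd2⟩ := w.exists_boundary_dart {l, σ l} (by simp) (by simpa using hz)
    have hadj := d.adj
    rcases hd1 with hd1 | hd1
    · rw [hd1, ← mem_neighborFinset, hNl, mem_singleton] at hadj
      exact hd2 (by simp [hadj])
    · rw [hd1] at hadj
      exact hd2 (by simp [h _ hadj])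
  refine ⟨l, σ l, q, rfl, hσ.2 l, hql, hq.ne', hNl, ?_⟩
  symm
  apply Finset.eq_of_subset_of_card_le
  · intro y hy
    simp only [mem_insert, mem_singleton] at hy
    rcases hy with rfl | rfl
    · exact hlp
    · simpa using hq
  · rw [card_neighborFinset_eq_degree, Finset.card_pair hql.symm]
    exact hp

section PendantPair

variable {l p q : V}

lemma isTree_deletePair (hG : G.IsTree) (hql : q ≠ l) (hqp : q ≠ p)
    (hl : G.neighborFinset l = {p}) (hp : G.neighborFinset p = {l, q}) :
    (deletePair G l p).IsTree := by
  have hl' : ∀ y, G.Adj l y ↔ y = p := fun y => by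
    rw [← mem_neighborFinset, hl, mem_singleton]
  have hp' : ∀ y, G.Adj p y ↔ y = l ∨ y = q := fun y => by
    rw [← mem_neighborFinset, hp]; simp
  refine ⟨?_, hG.isAcyclic.comap ⟨Subtype.val, fun h => h⟩ Subtype.val_injective⟩
  let f : V → {x // x ≠ l ∧ x ≠ p} := fun x => if h : x ≠ l ∧ x ≠ p then ⟨x, h⟩ else ⟨q, hql, hqp⟩
  have hf : ∀ x y, G.Adj x y → (deletePair G l p).Reachable (f x) (f y) := by
    intro x y hxy
    by_cases hx : x ≠ l ∧ x ≠ p <;> by_cases hy : y ≠ l ∧ y ≠ p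
    · have : (deletePair G l p).Adj (f x) (f y) := by simpa [f, hx, hy] using hxy
      exact this.reachable
    · have hxq : x = q := by
        have h1 := hl' x
        have h2 := hp' x
        have := hxy.symm
        grind
      have : f x = f y := by simp [f, hy, hxq]
      rw [this]
    · have hyq : y = q := by
        have h1 := hl' y
        have h2 := hp' y
        grind
      have : f x = f y := by simp [f, hx, hyq]
      rw [this]
    · have : f x = f y := by simp [f, hx, hy]
      rw [this]
  have hw : ∀ x y, G.Walk x y → (deletePair G l p).Reachable (f x) (f y) := by
    intro x y w
    induction w with
    | nil => rfl
    | cons h _ ih => exact (hf _ _ h).trans ih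
  have : Nonempty {x // x ≠ l ∧ x ≠ p} := ⟨⟨q, hql, hqp⟩⟩
  refine ⟨fun x y => ?_⟩
  obtain ⟨w⟩ := hG.connected x.1 y.1
  simpa [f, x.2, y.2] using hw _ _ w

lemma prod_pair_compl {M : Type*} [CommMonoid M] (hlp : l ≠ p) (g : V → M) :
    ∏ x, g x = g l * g p * ∏ x : {x // x ≠ l ∧ x ≠ p}, g x := by
  have h : ∏ x : {x // x ≠ l ∧ x ≠ p}, g x = ∏ x ∈ ({l, p} : Finset V)ᶜ, g x :=
    (Finset.prod_subtype _ (by simp) _).symm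
  rw [h, ← Finset.prod_pair hlp, Finset.prod_mul_prod_compl]

lemma sum_pair_compl (hlp : l ≠ p) (g : V → ℕ) :
    ∑ x, g x = g l + g p + ∑ x : {x // x ≠ l ∧ x ≠ p}, g x :=
  prod_pair_compl (M := Multiplicative ℕ) hlp g

lemma card_pair_compl (hlp : l ≠ p) :
    Fintype.card V = 2 + Fintype.card {x // x ≠ l ∧ x ≠ p} := by
  have := sum_pair_compl hlp (fun _ => 1)
  simpa using this

lemma prod_neighborFinset_deletePair {M : Type*} [CommMonoid M] (hlp : l ≠ p)
    (hl : G.neighborFinset l = {p}) (hp : G.neighborFinset p = {l, q})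
    (x : {x // x ≠ l ∧ x ≠ p}) (g : V → M) :
    ∏ v ∈ G.neighborFinset x, g v
      = (if (x : V) = q then g p else 1) * ∏ v ∈ (deletePair G l p).neighborFinset x, g v := by
  have hl' : ¬ G.Adj x l := fun h => by
    have := (mem_neighborFinset _ _ _).2 h.symm
    rw [hl, mem_singleton] at this
    exact x.2.2 this
  have hp' : G.Adj x p ↔ (x : V) = q := by
    rw [adj_comm, ← mem_neighborFinset, hp]
    simp [x.2.1]
  have h1 : ∏ v ∈ G.neighborFinset x, g v = ∏ v, if G.Adj x v then g v else 1 := by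
    rw [← Finset.prod_filter]
    exact Finset.prod_congr (by ext; simp) fun _ _ => rfl
  have h2 : ∏ v ∈ (deletePair G l p).neighborFinset x, g v
      = ∏ v : {x // x ≠ l ∧ x ≠ p}, if G.Adj x v then g v else 1 := by
    rw [← Finset.prod_filter]
    exact Finset.prod_congr (by ext; simp) fun _ _ => rfl
  rw [h1, h2, prod_pair_compl hlp]
  simp [hl', hp']

lemma degree_deletePair (hlp : l ≠ p)
    (hl : G.neighborFinset l = {p}) (hp : G.neighborFinset p = {l, q})
    (x : {x // x ≠ l ∧ x ≠ p}) :
    G.degree x = (if (x : V) = q then 1 else 0) + (deletePair G l p).degree x := by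
  have := prod_neighborFinset_deletePair (M := Multiplicative ℕ) hlp hl hp x
    (fun _ => Multiplicative.ofAdd 1)
  rw [← card_neighborFinset_eq_degree, ← card_neighborFinset_eq_degree, Finset.card_eq_sum_ones,
    Finset.card_eq_sum_ones]
  exact this

lemma neighborDegProd_deletePair (hql : q ≠ l) (hqp : q ≠ p) (hlp : l ≠ p)
    (hl : G.neighborFinset l = {p}) (hp : G.neighborFinset p = {l, q})
    (x : {x // x ≠ l ∧ x ≠ p}) :
    neighborDegProd G x = neighborDegProd (deletePair G l p) x
      + (if x = ⟨q, hql, hqp⟩ then neighborDegProd (deletePair G l p) ⟨q, hql, hqp⟩ else 0)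
      + if x ∈ (deletePair G l p).neighborFinset ⟨q, hql, hqp⟩ then
          ∏ v ∈ ((deletePair G l p).neighborFinset x).erase ⟨q, hql, hqp⟩,
            (deletePair G l p).degree v
        else 0 := by
  have hdp : G.degree p = 2 := by
    rw [← card_neighborFinset_eq_degree, hp, Finset.card_pair hql.symm]
  unfold neighborDegProd
  rw [prod_neighborFinset_deletePair hlp hl hp, hdp]
  simp only [degree_deletePair hlp hl hp]
  set Q : {x // x ≠ l ∧ x ≠ p} := ⟨q, hql, hqp⟩ with hQ
  have hval : ∀ y : {x // x ≠ l ∧ x ≠ p}, (y : V) = q ↔ y = Q := fun y => by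
    rw [hQ, Subtype.ext_iff]
  simp only [hval]
  have hne : ∀ s : Finset {x // x ≠ l ∧ x ≠ p}, Q ∉ s →
      ∏ v ∈ s, ((if v = Q then 1 else 0) + (deletePair G l p).degree v)
        = ∏ v ∈ s, (deletePair G l p).degree v := by
    intro s hs
    refine Finset.prod_congr rfl fun v hv => ?_
    rw [if_neg (fun h : v = Q => hs (h ▸ hv)), zero_add]
  by_cases hx : x = Q
  · rw [if_pos hx, if_pos hx, hx, hne _ (by simp), if_neg (by simp)]
    ring
  rw [if_neg hx, if_neg hx]
  by_cases hadj : (deletePair G l p).Adj Q x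
  · have hmem : Q ∈ (deletePair G l p).neighborFinset x := by
      rw [mem_neighborFinset]; exact hadj.symm
    rw [if_pos (by rwa [mem_neighborFinset]), ← Finset.mul_prod_erase _ _ hmem,
      hne _ (Finset.notMem_erase _ _), ← Finset.mul_prod_erase _ _ hmem, if_pos rfl]
    ring
  · rw [if_neg (by rwa [mem_neighborFinset]), hne]
    · ring
    · rw [mem_neighborFinset]
      exact fun h => hadj h.symm

end PendantPair

end Tree

open scoped Classical in
theorem sum_neighborDegProd_le (k : ℕ) : ∀ {V : Type*} [Fintype V] (G : SimpleGraph V),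
    G.IsTree → ∀ {σ : V → V}, IsPartnerMap G σ → Fintype.card V = 2 * (k + 1) →
    ∑ u, neighborDegProd G u ≤ 2 ^ k + 2 * k + (k + 1) ^ 2 := by
  induction k with
  | zero =>
    intro V _ G hG σ hσ hV
    have : ∀ u, neighborDegProd G u ≤ 1 := fun u =>
      Finset.prod_le_one' fun v _ => by have := G.degree_lt_card_verts v; omega
    have := Finset.sum_le_card_nsmul univ _ 1 fun u _ => this u
    rw [card_univ, hV] at this
    simpa using this
  | succ k ih =>
    intro V _ G hG σ hσ hV
    obtain ⟨l, p, q, hσl, hσp, hql, hqp, hl, hp⟩ := SimpleGraph.IsTree.exists_pendant_pair hG hσ hV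
    have hlp : l ≠ p := by
      have : p ∈ G.neighborFinset l := by simp [hl]
      exact ((mem_neighborFinset _ _ _).1 this).ne
    have hH := isTree_deletePair hG hql hqp hl hp
    have hcard := card_pair_compl hlp
    have hcard' : Fintype.card {x // x ≠ l ∧ x ≠ p} = 2 * (k + 1) := by omega
    have hτ : IsPartnerMap (deletePair G l p)
        fun x => ⟨σ x, fun h => x.2.2 (by rw [← hσ.2 x, h, hσl]),
          fun h => x.2.1 (by rw [← hσ.2 x, h, hσp])⟩ :=
      ⟨fun x => hσ.1 x, fun x => Subtype.ext (hσ.2 x)⟩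
    have h1 := ih _ hH hτ hcard'
    have h2 := hH.neighborDegProd_add_sum_le hτ ⟨q, hql, hqp⟩ hcard'
    have hMl : neighborDegProd G l = 2 := by
      simp [neighborDegProd, hl, ← card_neighborFinset_eq_degree, hp, Finset.card_pair hql.symm]
    have hMp : neighborDegProd G p = (deletePair G l p).degree ⟨q, hql, hqp⟩ + 1 := by
      have hdl : G.degree l = 1 := by rw [← card_neighborFinset_eq_degree, hl, card_singleton]
      have hdq := degree_deletePair hlp hl hp ⟨q, hql, hqp⟩
      rw [if_pos rfl] at hdq
      rw [neighborDegProd, hp, Finset.prod_pair hql.symm, hdl, hdq]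
      ring
    rw [sum_pair_compl hlp, hMl, hMp]
    simp only [neighborDegProd_deletePair hql hqp hlp hl hp, Finset.sum_add_distrib,
      Finset.sum_ite_eq', mem_univ, if_true, Finset.sum_ite_mem, Finset.univ_inter]
    rw [pow_succ 2 k]
    nlinarith

section Eccentricity

open scoped Classical

variable {V : Type*} [Fintype V] {G : SimpleGraph V}

lemma deg_eq_degree (u : V) : deg G u = G.degree u := by
  rw [deg, ← card_neighborFinset_eq_degree, ← Set.ncard_coe_finset, coe_neighborFinset]
  rfl

lemma Mprod_eq_neighborDegProd (u : V) : Mprod G u = neighborDegProd G u := by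
  have h : {v | G.Adj u v} = (G.neighborFinset u : Set V) := by
    rw [coe_neighborFinset]; rfl
  rw [Mprod, neighborDegProd, h, finprod_mem_coe_finset]
  exact Finset.prod_congr rfl fun v _ => deg_eq_degree v

lemma dist_le_ecc_s16 (u v : V) : G.dist u v ≤ ecc G u :=
  Finset.le_sup (f := fun v => G.dist u v) (mem_univ v)

lemma ecc_le_iff {u : V} {d : ℕ} : ecc G u ≤ d ↔ ∀ v, G.dist u v ≤ d := by
  simp [ecc]

lemma ecc_le_gdiam (u : V) : ecc G u ≤ gdiam G :=
  Finset.le_sup (f := fun u => ecc G u) (mem_univ u)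

lemma dist_le_gdiam_s16 (u v : V) : G.dist u v ≤ gdiam G :=
  (dist_le_ecc_s16 u v).trans (ecc_le_gdiam u)

lemma exists_dist_eq_gdiam [Nonempty V] (G : SimpleGraph V) : ∃ u v, G.dist u v = gdiam G := by
  obtain ⟨u, -, hu⟩ := Finset.exists_mem_eq_sup univ univ_nonempty fun u => ecc G u
  obtain ⟨v, -, hv⟩ := Finset.exists_mem_eq_sup univ univ_nonempty fun v => G.dist u v
  exact ⟨u, v, hv.symm.trans hu.symm⟩

lemma SimpleGraph.Connected.ecc_pos [Nontrivial V] (hG : G.Connected) (u : V) : 0 < ecc G u := by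
  obtain ⟨v, hv⟩ := exists_ne u
  exact (hG.pos_dist_of_ne hv.symm).trans_le (dist_le_ecc_s16 u v)

/-- A tree of diameter four has a vertex of eccentricity at most two. -/
lemma SimpleGraph.IsTree.exists_ecc_le_two (hG : G.IsTree) (hd : gdiam G = 4) :
    ∃ x, ecc G x ≤ 2 := by
  have := hG.connected.nonempty
  obtain ⟨u, v, huv⟩ := exists_dist_eq_gdiam G
  rw [hd] at huv
  obtain ⟨w, hw⟩ := hG.connected.exists_walk_length_eq_dist u v
  rw [huv] at hw
  match w, hw with
  | .cons (v := a) hua (.cons (v := x) hax (.cons (v := b) hxb (.cons hbv .nil))), _ =>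
    refine ⟨x, ecc_le_iff.2 fun y => ?_⟩
    rw [dist_comm]
    by_contra! h3
    have far : ∀ c z, G.Adj x c → G.Adj c z → z ≠ x → G.dist y c = G.dist y x + 1 → False := by
      intro c z hxc hcz hzx hc
      have h4 := dist_le_gdiam_s16 (G := G) y z
      rcases hG.dist_eq_dist_add_one_of_adj y hcz with h | h
      · exact hzx (hG.eq_of_adj_of_dist_succ hcz.symm hxc h.symm hc.symm)
      · omega
    have hux : u ≠ x := by
      rintro rfl
      have := dist_le (Walk.cons hxb (Walk.cons hbv Walk.nil))
      simp [huv] at this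
    have hvx : v ≠ x := by
      rintro rfl
      have := dist_le (Walk.cons hua (Walk.cons hax Walk.nil))
      simp [huv] at this
    rcases hG.dist_eq_dist_add_one_of_adj y hax with h1 | h1
    · exact far a u hax.symm hua.symm hux h1
    rcases hG.dist_eq_dist_add_one_of_adj y hxb with h2 | h2
    · have hab := hG.eq_of_adj_of_dist_succ hax hxb.symm h1.symm h2.symm
      subst hab
      have := dist_le (Walk.cons hua (Walk.cons hbv Walk.nil))
      simp [huv] at this
    · exact far b v hxb hbv hvx h2

lemma SimpleGraph.IsTree.isTB_of_ecc_le_two (hG : G.IsTree) {σ : V → V} (hσ : IsPartnerMap G σ)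
    {k : ℕ} (hk : 2 ≤ k) (hV : Fintype.card V = 2 * (k + 1)) {c : V} (hc : ecc G c ≤ 2) :
    IsTB G (2 * (k + 1)) (k + 1) := by
  have hc2 : ∀ v, G.dist c v ≤ 2 := ecc_le_iff.1 hc
  have hadj : ∀ v, Odd (G.dist c v) → G.Adj c v := by
    intro v hv
    have := hc2 v
    apply dist_eq_one_iff_adj.1
    obtain ⟨j, hj⟩ := hv
    omega
  have hdeg : G.degree c = k + 1 := by
    rw [← (hG.card_classes hσ c hV).1, ← card_neighborFinset_eq_degree]
    congr 1
    ext v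
    simp only [mem_neighborFinset, oddClass, mem_filter, mem_univ, true_and]
    exact ⟨fun h => by simp [dist_eq_one_iff_adj.2 h], hadj v⟩
  have huniq : ∀ w u v, w ≠ c → G.Adj c v → G.Adj v w → G.Adj w u → u = v := by
    intro w u v hw hcv hvw hwu
    have hu : G.Adj c u := by
      apply hadj
      rw [hG.odd_dist_iff c hwu.symm]
      simp [hG.dist_eq_two hcv hvw hw.symm]
    exact hG.eq_of_common_neighbors hw.symm hu hwu.symm hcv hvw
  have hdeg2 : ∀ v, G.Adj c v → G.degree v ≤ 2 := by
    intro v hv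
    rw [← card_neighborFinset_eq_degree]
    refine (Finset.card_le_card fun y hy => ?_).trans (Finset.card_le_two (a := c) (b := σ v))
    rw [mem_neighborFinset] at hy
    simp only [mem_insert, mem_singleton]
    by_cases hyc : y = c
    · exact Or.inl hyc
    · exact Or.inr (by rw [← huniq y (σ y) v hyc hv hy (hσ.1 y), hσ.2])
  obtain ⟨v, hv, v', hv', hvv⟩ : ∃ v ∈ (G.neighborFinset c).erase (σ c),
      ∃ v' ∈ (G.neighborFinset c).erase (σ c), v ≠ v' := by
    apply Finset.one_lt_card.1
    have := Finset.pred_card_le_card_erase (s := G.neighborFinset c) (a := σ c)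
    rw [card_neighborFinset_eq_degree, hdeg] at this
    omega
  rw [mem_erase, mem_neighborFinset] at hv hv'
  have hσv : ∀ x, x ≠ σ c → σ x ≠ c := fun x hx h => hx (by rw [← h, hσ.2])
  have hdist : G.dist (σ v) (σ v') = 4 := by
    have h2 := hG.dist_eq_two (hσ.1 v).symm hv.2.symm (hσv v hv.1)
    have h0 : ¬ G.Adj (σ v) v' := fun h => hvv (huniq (σ v) v' v (hσv v hv.1) hv.2 (hσ.1 v) h).symm
    have h1 : G.dist (σ v) v' ≠ 1 := fun h => h0 (dist_eq_one_iff_adj.1 h)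
    have h3 := hG.dist_eq_dist_add_one_of_adj (σ v) hv'.2
    have h4 := hG.dist_eq_dist_add_one_of_adj (σ v) (hσ.1 v')
    have h5 : G.dist (σ v) (σ v') ≠ 2 := by
      intro h
      obtain ⟨x, hx1, hx2⟩ := hG.connected.exists_common_neighbor h
      have e1 := huniq (σ v) x v (hσv v hv.1) hv.2 (hσ.1 v) hx1
      have e2 := huniq (σ v') x v' (hσv v' hv'.1) hv'.2 (hσ.1 v') hx2.symm
      exact hvv (e1.symm.trans e2)
    omega
  refine ⟨hG, hV, le_antisymm ?_ (hdist ▸ dist_le_gdiam_s16 _ _), c, fun x => ?_, ?_, ?_⟩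
  · refine Finset.sup_le fun x _ => ecc_le_iff.2 fun y => ?_
    have h1 := hG.connected.dist_triangle (u := x) (v := c) (w := y)
    have h2 := hc2 x
    have h3 := hc2 y
    rw [dist_comm] at h2
    omega
  · have h1 := hG.connected.dist_triangle (u := σ v) (v := x) (w := σ v')
    have h2 := dist_le_ecc_s16 (G := G) x (σ v)
    have h3 := dist_le_ecc_s16 (G := G) x (σ v')
    rw [dist_comm] at h2
    omega
  · rw [deg_eq_degree, hdeg]
  · intro x y hx hy
    rw [deg_eq_degree, deg_eq_degree]
    have := hdeg2 x hx
    have := IsPartnerMap.one_le_degree hσ y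
    omega

lemma IsTB.two_le {k : ℕ} (h : IsTB G (2 * (k + 1)) (k + 1)) : 2 ≤ k := by
  obtain ⟨hG, hV, hd, -⟩ := h
  have := hG.connected.nonempty
  obtain ⟨u, v, huv⟩ := exists_dist_eq_gdiam G
  obtain ⟨p, hp, hl⟩ := hG.connected.exists_path_of_dist u v
  have := hp.length_lt
  omega

/-- A lower bound (in fact the exact value) for the index of the degree balanced tree. -/
lemma IsTB.le_xiAC {k : ℕ} (h : IsTB G (2 * (k + 1)) (k + 1)) :
    (2 : ℝ) ^ k / 2 + (k + 1) ^ 2 / 3 + k / 2 ≤ xiAC G := by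
  have hk := h.two_le
  obtain ⟨hG, hV, hd, c, hmin, hdeg, hbal⟩ := h
  have : Nontrivial V := Fintype.one_lt_card_iff_nontrivial.1 (by omega)
  have hpos : ∀ v, 1 ≤ G.degree v := fun v =>
    hG.connected.preconnected.degree_pos_of_nontrivial v
  rw [deg_eq_degree] at hdeg
  obtain ⟨x, hx⟩ := hG.exists_ecc_le_two hd
  have hc : ecc G c ≤ 2 := (hmin x).trans hx
  set N := G.neighborFinset c with hN
  set W := (insert c N)ᶜ with hW
  have hcN : c ∉ N := by simp [hN]
  have hNcard : #N = k + 1 := by rw [hN, card_neighborFinset_eq_degree, hdeg]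
  have hWcard : #W = k := by
    rw [hW, Finset.card_compl, Finset.card_insert_of_notMem hcN, hNcard]
    omega
  have hWN : ∀ w ∈ W, ∃ v ∈ N, G.Adj v w ∧ w ≠ c := by
    intro w hw
    simp only [hW, hN, mem_compl, mem_insert, mem_neighborFinset, not_or] at hw
    have h0 := hG.connected.pos_dist_of_ne (Ne.symm hw.1)
    have h1 : G.dist c w ≠ 1 := fun h => hw.2 (dist_eq_one_iff_adj.1 h)
    have h2 := ecc_le_iff.1 hc w
    obtain ⟨v, hcv, hvw⟩ := hG.connected.exists_common_neighbor (u := c) (v := w) (by omega)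
    exact ⟨v, by simpa [hN] using hcv, hvw, hw.1⟩
  have hupper : ∑ v ∈ N, (G.degree v - 1) ≤ k := by
    have h1 := G.sum_degrees_eq_twice_card_edges
    have h2 := hG.card_edgeFinset
    rw [← Finset.sum_add_sum_compl (insert c N), ← hW, Finset.sum_insert hcN, hdeg] at h1
    have h3 : #W ≤ ∑ w ∈ W, G.degree w := by
      simpa using Finset.card_nsmul_le_sum W _ 1 fun w _ => hpos w
    have h4 : ∑ v ∈ N, (G.degree v - 1) + #N = ∑ v ∈ N, G.degree v := by
      rw [Finset.card_eq_sum_ones, ← Finset.sum_add_distrib]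
      exact Finset.sum_congr rfl fun v _ => Nat.sub_add_cancel (hpos v)
    omega
  have hlower : k ≤ ∑ v ∈ N, (G.degree v - 1) := by
    have hsub : W ⊆ N.biUnion fun v => (G.neighborFinset v).erase c := by
      intro w hw
      obtain ⟨v, hv, hvw, hwc⟩ := hWN w hw
      simp only [mem_biUnion, mem_erase, mem_neighborFinset]
      exact ⟨v, hv, hwc, hvw⟩
    rw [← hWcard]
    refine (Finset.card_le_card hsub).trans (Finset.card_biUnion_le.trans (le_of_eq ?_))
    refine Finset.sum_congr rfl fun v hv => ?_
    rw [Finset.card_erase_of_mem (by simpa [hN, adj_comm] using hv), card_neighborFinset_eq_degree]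
  obtain ⟨v₀, hv₀, hdeg₀⟩ : ∃ v ∈ N, G.degree v ≤ 1 := by
    by_contra! h
    have : #N ≤ ∑ v ∈ N, (G.degree v - 1) := by
      simpa using Finset.card_nsmul_le_sum N _ 1 fun v hv => Nat.le_sub_one_of_lt (h v hv)
    omega
  have hMc : 2 ^ k ≤ neighborDegProd G c := by
    refine (Nat.pow_le_pow_right two_pos hlower).trans ?_
    rw [← Finset.prod_pow_eq_pow_sum]
    refine Finset.prod_le_prod' fun v hv => ?_
    have h1 := hbal v v₀ (by simpa [hN] using hv) (by simpa [hN] using hv₀)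
    rw [deg_eq_degree, deg_eq_degree] at h1
    have h2 := hpos v
    have : G.degree v = 1 ∨ G.degree v = 2 := by omega
    rcases this with h | h <;> simp [h]
  have hMN : ∀ v ∈ N, k + 1 ≤ neighborDegProd G v := by
    intro v hv
    rw [← hdeg]
    exact Finset.single_le_prod' (f := fun v => G.degree v) (fun u _ => hpos u)
      (by simpa [hN, adj_comm] using hv)
  have hMW : ∀ w ∈ W, 2 ≤ neighborDegProd G w := by
    intro w hw
    obtain ⟨v, hv, hvw, hwc⟩ := hWN w hw
    have h1 : 2 ≤ G.degree v := by
      rw [← card_neighborFinset_eq_degree, ← Finset.card_pair hwc]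
      apply Finset.card_le_card
      intro y hy
      simp only [mem_insert, mem_singleton] at hy
      rcases hy with rfl | rfl
      · simpa using hvw
      · simpa [hN, adj_comm] using hv
    exact h1.trans (Finset.single_le_prod' (f := fun v => G.degree v) (fun u _ => hpos u)
      (by simpa [adj_comm] using hvw))
  have heN : ∀ v ∈ N, ecc G v ≤ 3 := by
    intro v hv
    refine ecc_le_iff.2 fun y => ?_
    have h1 := hG.connected.dist_triangle (u := v) (v := c) (w := y)
    have h2 : G.dist v c = 1 := dist_eq_one_iff_adj.2 (by simpa [hN, adj_comm] using hv)
    have h3 := ecc_le_iff.1 hc y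
    omega
  have hterm : ∀ (v : V) (a b : ℕ), a ≤ neighborDegProd G v → ecc G v ≤ b →
      (a : ℝ) / b ≤ (Mprod G v : ℝ) / (ecc G v : ℝ) := by
    intro v a b ha hb
    have h0 := hG.connected.ecc_pos v
    rw [Mprod_eq_neighborDegProd]
    exact div_le_div₀ (by positivity) (by exact_mod_cast ha) (by exact_mod_cast h0)
      (by exact_mod_cast hb)
  have hsN := Finset.card_nsmul_le_sum N (fun v => (Mprod G v : ℝ) / (ecc G v : ℝ)) _
    fun v hv => hterm v _ _ (hMN v hv) (heN v hv)
  have hsW := Finset.card_nsmul_le_sum W (fun v => (Mprod G v : ℝ) / (ecc G v : ℝ)) _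
    fun v hv => hterm v _ _ (hMW v hv) (hd ▸ ecc_le_gdiam v)
  have hsc := hterm c _ _ hMc hc
  rw [xiAC, ← Finset.sum_add_sum_compl (insert c N), ← hW, Finset.sum_insert hcN]
  rw [hNcard, nsmul_eq_mul] at hsN
  rw [hWcard, nsmul_eq_mul] at hsW
  push_cast at hsN hsW hsc
  nlinarith

lemma SimpleGraph.IsTree.xiAC_lt (hG : G.IsTree) {σ : V → V} (hσ : IsPartnerMap G σ)
    {k : ℕ} (hV : Fintype.card V = 2 * (k + 1)) (he : ∀ v, 3 ≤ ecc G v) :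
    xiAC G < (2 : ℝ) ^ k / 2 + (k + 1) ^ 2 / 3 + k / 2 := by
  have h1 : xiAC G ≤ (∑ v, (neighborDegProd G v : ℝ)) / 3 := by
    rw [xiAC, Finset.sum_div]
    refine Finset.sum_le_sum fun v _ => ?_
    rw [Mprod_eq_neighborDegProd]
    exact div_le_div_of_nonneg_left (by positivity) (by norm_num) (by exact_mod_cast he v)
  have h2 : ∑ v, (neighborDegProd G v : ℝ) ≤ 2 ^ k + 2 * k + (k + 1) ^ 2 := by
    exact_mod_cast sum_neighborDegProd_le k G hG hσ hV
  have h3 : (k : ℝ) < 2 ^ k := by exact_mod_cast Nat.lt_two_pow_self (n := k)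
  linarith

end Eccentricity

/-- Corollary: Let `T ≠ TB_{n,n/2}` be a tree on `n` vertices with a perfect matching.
Then `ξ^{ac}(T) < ξ^{ac}(TB_{n,n/2})`. -/
theorem xiAC_matching_max (n : ℕ) {V : Type*} [Fintype V] (T : SimpleGraph V)
    (hT : T.IsTree) (hn : Fintype.card V = n)
    (hpm : ∃ M : T.Subgraph, M.IsPerfectMatching)
    (hne : ¬ IsTB T n (n / 2))
    {V' : Type*} [Fintype V'] (T₀ : SimpleGraph V')
    (hT₀ : IsTB T₀ n (n / 2)) :
    xiAC T < xiAC T₀ := by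
  obtain ⟨M, hM⟩ := hpm
  obtain ⟨σ, hσ⟩ := exists_isPartnerMap hM
  obtain ⟨m, hm⟩ := hM.even_card
  have hpos : 0 < Fintype.card V := Fintype.card_pos_iff.2 hT.connected.nonempty
  obtain ⟨k, rfl⟩ : ∃ k, m = k + 1 := ⟨m - 1, by omega⟩
  obtain rfl : n = 2 * (k + 1) := by omega
  rw [Nat.mul_div_cancel_left _ two_pos] at hne hT₀
  refine (hT.xiAC_lt hσ hn fun v => ?_).trans_le hT₀.le_xiAC
  by_contra! h
  exact hne (hT.isTB_of_ecc_le_two hσ hT₀.two_le hn (Nat.le_of_lt_succ h))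
end
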